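/- (Comparison principle for the nonlinear Kolmogorov PIDE.) Let Θ be a nonempty measurable set of Lévy triplets with 𝒦 := sup_{(b,c,F)∈Θ} { ∫_{ℝ^d} |z|∧|z|² F(dz) + |b| + |c| } < ∞ and 𝒦_ε := sup_{F ∈ Θ₃} ∫_{|z|≤ε} |z|² F(dz) → 0 as ε → 0, where Θ₃ is the projection of Θ onto 𝓛, and let ψ ∈ C_{b,Lip}(ℝ^d). Let u be a bounded upper semicontinuous viscosity subsolution and v a bounded lower semicontinuous viscosity supersolution of the PIDE ∂_t w(t,x) − G(D_x w(t,x), D²_{xx} w(t,x), w(t,x+·)) = 0 on (0,∞)×ℝ^d. If u(0,·), v(0,·) ∈ C_{b,Lip}(ℝ^d) and u(0,·) ≤ v(0,·), then u ≤ v on [0,∞)×ℝ^d. -/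

import Mathlib

open MeasureTheory Filter Set
open scoped NNReal ENNReal Topology

noncomputable section

/-- Euclidean space `ℝ^d`. -/
abbrev Eu (d : ℕ) : Type := EuclideanSpace ℝ (Fin d)

/-- Matrices carry the product (= Borel) σ-algebra. -/
instance matrixMeasurableSpace {d : ℕ} : MeasurableSpace (Matrix (Fin d) (Fin d) ℝ) :=
  inferInstanceAs (MeasurableSpace (Fin d → Fin d → ℝ))

/-- The truncation function `h(z) = z 1_{|z| ≤ 1}`. -/
def trunc {d : ℕ} (z : Eu d) : Eu d := if ‖z‖ ≤ 1 then z else 0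

/-- `F` is a Lévy measure on `ℝ^d`: `F({0}) = 0` and `∫ |z|² ∧ 1 F(dz) < ∞`. -/
def IsLevyMeasure {d : ℕ} (F : Measure (Eu d)) : Prop :=
  F {0} = 0 ∧ (∫⁻ z, ENNReal.ofReal (min (‖z‖ ^ 2) 1) ∂F) < ⊤

/-- `Θ` is a set of Lévy triplets `(b, c, F)`: `c` is symmetric nonnegative definite and
`F` is a Lévy measure. -/
def IsLevyTripletSet {d : ℕ}
    (Θ : Set (Eu d × Matrix (Fin d) (Fin d) ℝ × Measure (Eu d))) : Prop :=
  ∀ x ∈ Θ, x.2.1.PosSemidef ∧ IsLevyMeasure x.2.2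

/-- The condition `𝒦 = sup_{(b,c,F) ∈ Θ} { ∫ |z| ∧ |z|² F(dz) + |b| + |c| } < ∞`. -/
def HasUniformBound {d : ℕ}
    (Θ : Set (Eu d × Matrix (Fin d) (Fin d) ℝ × Measure (Eu d))) : Prop :=
  ∃ K : ℝ≥0, ∀ x ∈ Θ,
    (∫⁻ z, ENNReal.ofReal (min ‖z‖ (‖z‖ ^ 2)) ∂x.2.2)
      + ENNReal.ofReal ‖x.1‖ + ∑ i, ∑ j, ENNReal.ofReal |x.2.1 i j| ≤ K

/-- The condition `𝒦_ε := sup_{F ∈ Θ₃} ∫_{|z| ≤ ε} |z|² F(dz) → 0` as `ε ↓ 0`. -/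
def HasVanishingSmallJumps {d : ℕ}
    (Θ : Set (Eu d × Matrix (Fin d) (Fin d) ℝ × Measure (Eu d))) : Prop :=
  Tendsto (fun ε : ℝ => ⨆ x ∈ Θ, ∫⁻ z in {z : Eu d | ‖z‖ ≤ ε},
      ((‖z‖₊ : ℝ≥0∞) ^ 2) ∂x.2.2)
    (nhdsWithin 0 (Set.Ioi 0)) (nhds 0)

/-- The nonlinearity
`G(p,q,f) = sup_{(b,c,F) ∈ Θ} { p·b + ½ tr[q c] + ∫ [f(z) - f(0) - D f(0)·h(z)] F(dz) }`. -/
def Gop {d : ℕ} (Θ : Set (Eu d × Matrix (Fin d) (Fin d) ℝ × Measure (Eu d)))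
    (p : Eu d) (q : Matrix (Fin d) (Fin d) ℝ) (f : Eu d → ℝ) : ℝ :=
  sSup {r : ℝ | ∃ x ∈ Θ,
    r = (∑ i, p i * x.1 i) + (1 / 2) * (q * x.2.1).trace
      + ∫ z, (f z - f 0 - fderiv ℝ f 0 (trunc z)) ∂x.2.2}

/-- The approximating nonlinearity `G^κ(p,q,f,g)`, where jumps of size `≤ κ` are handled
with the test function `g` and jumps of size `> κ` with `f`. -/
def Gkop {d : ℕ} (Θ : Set (Eu d × Matrix (Fin d) (Fin d) ℝ × Measure (Eu d)))
    (κ : ℝ) (p : Eu d) (q : Matrix (Fin d) (Fin d) ℝ) (f g : Eu d → ℝ) : ℝ :=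
  sSup {r : ℝ | ∃ x ∈ Θ,
    r = (∑ i, p i * x.1 i) + (1 / 2) * (q * x.2.1).trace
      + (∫ z in {z : Eu d | κ < ‖z‖}, (f z - f 0 - fderiv ℝ g 0 (trunc z)) ∂x.2.2)
      + (∫ z in {z : Eu d | ‖z‖ ≤ κ}, (g z - g 0 - fderiv ℝ g 0 (trunc z)) ∂x.2.2)}

/-- `f ∈ C^{1,2}((0,∞) × ℝ^d)`: jointly continuous, continuously differentiable in `t`
and twice continuously differentiable in `x` on `(0,∞) × ℝ^d`. -/
def IsC12 {d : ℕ} (f : ℝ → Eu d → ℝ) : Prop :=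
  ContinuousOn (fun pt : ℝ × Eu d => f pt.1 pt.2) (Set.Ioi 0 ×ˢ Set.univ) ∧
  (∀ x, ContDiffOn ℝ 1 (fun t => f t x) (Set.Ioi 0)) ∧
  (∀ t ∈ Set.Ioi (0 : ℝ), ContDiff ℝ 2 (f t)) ∧
  ContinuousOn (fun pt : ℝ × Eu d => fderiv ℝ (f pt.1) pt.2) (Set.Ioi 0 ×ˢ Set.univ) ∧
  ContinuousOn (fun pt : ℝ × Eu d => fderiv ℝ (fderiv ℝ (f pt.1)) pt.2)
    (Set.Ioi 0 ×ˢ Set.univ)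

/-- `f ∈ C_b^{1,2}((0,∞) × ℝ^d)`: `f ∈ C^{1,2}` with `f` and its derivatives bounded. -/
def IsC12b {d : ℕ} (f : ℝ → Eu d → ℝ) : Prop :=
  IsC12 f ∧
  ∃ C : ℝ, ∀ t ∈ Set.Ioi (0 : ℝ), ∀ x,
    |f t x| ≤ C ∧ |deriv (fun s => f s x) t| ≤ C ∧
    ‖fderiv ℝ (f t) x‖ ≤ C ∧ ‖fderiv ℝ (fderiv ℝ (f t)) x‖ ≤ C

/-- `f` is a bounded semicontinuous (upper or lower) function on `(0,∞) × ℝ^d`. -/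
def IsBoundedSC {d : ℕ} (f : ℝ → Eu d → ℝ) : Prop :=
  (UpperSemicontinuousOn (fun pt : ℝ × Eu d => f pt.1 pt.2) (Set.Ioi 0 ×ˢ Set.univ) ∨
    LowerSemicontinuousOn (fun pt : ℝ × Eu d => f pt.1 pt.2) (Set.Ioi 0 ×ˢ Set.univ)) ∧
  ∃ C : ℝ, ∀ t ∈ Set.Ioi (0 : ℝ), ∀ x, |f t x| ≤ C

/-- `φ ∈ C^{2,3}_b((0,∞) × ℝ^d)`: bounded continuous derivatives up to order 2 in `t` and
3 in `x`. -/
def IsC23b {d : ℕ} (φ : ℝ → Eu d → ℝ) : Prop :=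
  ContinuousOn (fun pt : ℝ × Eu d => φ pt.1 pt.2) (Set.Ioi 0 ×ˢ Set.univ) ∧
  (∀ x, ContDiffOn ℝ 2 (fun t => φ t x) (Set.Ioi 0)) ∧
  (∀ t ∈ Set.Ioi (0 : ℝ), ContDiff ℝ 3 (φ t)) ∧
  ∃ C : ℝ, ∀ t ∈ Set.Ioi (0 : ℝ), ∀ x,
    |φ t x| ≤ C ∧ |deriv (fun s => φ s x) t| ≤ C ∧
    |deriv (deriv (fun s => φ s x)) t| ≤ C ∧
    ‖fderiv ℝ (φ t) x‖ ≤ C ∧ ‖iteratedFDeriv ℝ 2 (φ t) x‖ ≤ C ∧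
    ‖iteratedFDeriv ℝ 3 (φ t) x‖ ≤ C

/-- The Hessian matrix `D²_{xx} f(x)` of a function `f : ℝ^d → ℝ`. -/
def hessMatrix {d : ℕ} (f : Eu d → ℝ) (x : Eu d) : Matrix (Fin d) (Fin d) ℝ :=
  Matrix.of fun i j =>
    iteratedFDeriv ℝ 2 f x ![EuclideanSpace.single i (1 : ℝ), EuclideanSpace.single j 1]

/-- `u` is a viscosity subsolution of `∂_t w - G(D_x w, D²_{xx} w, w(t, x + ·)) = 0` on
`(0,∞) × ℝ^d`. -/
def IsViscositySubsolution {d : ℕ}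
    (Θ : Set (Eu d × Matrix (Fin d) (Fin d) ℝ × Measure (Eu d)))
    (u : ℝ → Eu d → ℝ) : Prop :=
  ∀ φ : ℝ → Eu d → ℝ, IsC23b φ →
    (∀ t ∈ Set.Ioi (0 : ℝ), ∀ x, u t x ≤ φ t x) →
    ∀ t ∈ Set.Ioi (0 : ℝ), ∀ x, φ t x = u t x →
      deriv (fun s => φ s x) t
        - Gop Θ (gradient (φ t) x) (hessMatrix (φ t) x) (fun z => φ t (x + z)) ≤ 0

/-- `v` is a viscosity supersolution of `∂_t w - G(D_x w, D²_{xx} w, w(t, x + ·)) = 0` on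
`(0,∞) × ℝ^d`. -/
def IsViscositySupersolution {d : ℕ}
    (Θ : Set (Eu d × Matrix (Fin d) (Fin d) ℝ × Measure (Eu d)))
    (v : ℝ → Eu d → ℝ) : Prop :=
  ∀ φ : ℝ → Eu d → ℝ, IsC23b φ →
    (∀ t ∈ Set.Ioi (0 : ℝ), ∀ x, φ t x ≤ v t x) →
    ∀ t ∈ Set.Ioi (0 : ℝ), ∀ x, φ t x = v t x →
      0 ≤ deriv (fun s => φ s x) t
        - Gop Θ (gradient (φ t) x) (hessMatrix (φ t) x) (fun z => φ t (x + z))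

section Helpers

set_option maxSynthPendingDepth 5
set_option linter.unusedSectionVars false
set_option linter.unusedVariables false
set_option linter.style.haveILetI false

/-! ## Parametric integrals -/

/-- Differentiation of weighted translation averages, together with derivative bounds. -/
theorem param_contDiff {E : Type} [NormedAddCommGroup E] [NormedSpace ℝ E]
    [MeasurableSpace E] [BorelSpace E] [SecondCountableTopology E]
    (μ : Measure E) (b : E → ℝ) (hb : Continuous b) (n : ℕ) :
    ∀ (F : Type) [NormedAddCommGroup F] [NormedSpace ℝ F] [CompleteSpace F]
      (g : E → F) (B : ℕ → ℝ), ContDiff ℝ n g →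
      (∀ k ≤ n, ∀ x₀ : E, ∃ β : E → ℝ, Integrable β μ ∧ (∫ q, β q ∂μ) ≤ B k ∧
        ∀ x ∈ Metric.ball x₀ 1, ∀ q, ‖b q‖ * ‖iteratedFDeriv ℝ k g (x + q)‖ ≤ β q) →
      ContDiff ℝ n (fun x => ∫ q, b q • g (x + q) ∂μ) ∧
      ∀ k ≤ n, ∀ x, ‖iteratedFDeriv ℝ k (fun x => ∫ q, b q • g (x + q) ∂μ) x‖ ≤ B k := by
  induction n with
  | zero =>
    intro F _ _ _ g B hg H
    have hgc : Continuous g := hg.continuous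
    constructor
    · rw [Nat.cast_zero, contDiff_zero, continuous_iff_continuousAt]
      intro x₀
      obtain ⟨β, hβ, -, hβb⟩ := H 0 le_rfl x₀
      refine continuousAt_of_dominated (bound := β) ?_ ?_ hβ ?_
      · exact Eventually.of_forall fun x => by
          have : Continuous fun q => b q • g (x + q) := by fun_prop
          exact this.aestronglyMeasurable
      · filter_upwards [Metric.ball_mem_nhds x₀ one_pos] with x hx
        refine Eventually.of_forall fun q => ?_
        have := hβb x hx q
        rwa [norm_iteratedFDeriv_zero, ← norm_smul] at this
      · exact Eventually.of_forall fun q => by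
          have : Continuous fun x => b q • g (x + q) := by fun_prop
          exact this.continuousAt
    · intro k hk x
      obtain rfl : k = 0 := by omega
      obtain ⟨β, hβ, hβi, hβb⟩ := H 0 le_rfl x
      rw [norm_iteratedFDeriv_zero]
      refine (norm_integral_le_of_norm_le hβ (Eventually.of_forall fun q => ?_)).trans hβi
      have := hβb x (Metric.mem_ball_self one_pos) q
      rwa [norm_iteratedFDeriv_zero, ← norm_smul] at this
  | succ n ih =>
    intro F _ _ _ g B hg H
    have hgc : Continuous g := hg.continuous
    have hgs : ContDiff ℝ ((n : WithTop ℕ∞) + 1) g := by exact_mod_cast hg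
    have hg' : ContDiff ℝ n (fderiv ℝ g) := (contDiff_succ_iff_fderiv.1 hgs).2.2
    have hgd : Differentiable ℝ g := (contDiff_succ_iff_fderiv.1 hgs).1
    have hgc' : Continuous (fderiv ℝ g) := hg'.continuous
    have hder : ∀ x₀, HasFDerivAt (fun x => ∫ q, b q • g (x + q) ∂μ)
        (∫ q, b q • fderiv ℝ g (x₀ + q) ∂μ) x₀ := by
      intro x₀
      obtain ⟨β, hβ, -, hβb⟩ := H 1 (by omega) x₀
      obtain ⟨β₀, hβ₀, -, hβb₀⟩ := H 0 (by omega) x₀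
      refine hasFDerivAt_integral_of_dominated_of_fderiv_le (bound := β)
        (F' := fun x q => b q • fderiv ℝ g (x + q))
        (Metric.ball_mem_nhds x₀ one_pos) ?_ ?_ ?_ ?_ hβ ?_
      · exact Eventually.of_forall fun x => by
          have : Continuous fun q => b q • g (x + q) := by fun_prop
          exact this.aestronglyMeasurable
      · refine hβ₀.mono' ?_ ?_
        · have : Continuous fun q => b q • g (x₀ + q) := by fun_prop
          exact this.aestronglyMeasurable
        · refine Eventually.of_forall fun q => ?_
          have := hβb₀ x₀ (Metric.mem_ball_self one_pos) q
          rwa [norm_iteratedFDeriv_zero, ← norm_smul] at this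
      · have : Continuous fun q => b q • fderiv ℝ g (x₀ + q) := by fun_prop
        exact this.aestronglyMeasurable
      · refine Eventually.of_forall fun q x hx => ?_
        have := hβb x hx q
        rwa [norm_iteratedFDeriv_one, ← norm_smul] at this
      · refine Eventually.of_forall fun q x hx => ?_
        have h1 : HasFDerivAt (fun x => g (x + q)) (fderiv ℝ g (x + q)) x :=
          (hasFDerivAt_comp_add_right q).2 (hgd (x + q)).hasFDerivAt
        exact h1.const_smul (b q)
    have hfd : fderiv ℝ (fun x => ∫ q, b q • g (x + q) ∂μ)
        = fun x => ∫ q, b q • fderiv ℝ g (x + q) ∂μ := by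
      funext x; exact (hder x).fderiv
    obtain ⟨h1, h2⟩ := ih (E →L[ℝ] F) (fderiv ℝ g) (fun k => B (k + 1)) hg' (by
      intro k hk x₀
      obtain ⟨β, hβ, hβi, hβb⟩ := H (k + 1) (by omega) x₀
      refine ⟨β, hβ, hβi, fun x hx q => ?_⟩
      rw [norm_iteratedFDeriv_fderiv]
      exact hβb x hx q)
    constructor
    · rw [Nat.cast_succ, contDiff_succ_iff_fderiv]
      refine ⟨fun x => (hder x).differentiableAt, by simp, ?_⟩
      rw [hfd]; exact h1
    · intro k hk x
      cases k with
      | zero =>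
        obtain ⟨β, hβ, hβi, hβb⟩ := H 0 (by omega) x
        rw [norm_iteratedFDeriv_zero]
        refine (norm_integral_le_of_norm_le hβ (Eventually.of_forall fun q => ?_)).trans hβi
        have := hβb x (Metric.mem_ball_self one_pos) q
        rwa [norm_iteratedFDeriv_zero, ← norm_smul] at this
      | succ k =>
        rw [← norm_iteratedFDeriv_fderiv, hfd]
        exact h2 k (by omega) x

/-- Functions of class `C³` that are bounded, with derivatives of order `1, 2, 3` bounded
by `A`. -/
structure CB {E : Type} [NormedAddCommGroup E] [NormedSpace ℝ E] (A : ℝ) (f : E → ℝ) :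
    Prop where
  cd : ContDiff ℝ 3 f
  bd : ∃ B, ∀ x, |f x| ≤ B
  der : ∀ k, 1 ≤ k → k ≤ 3 → ∀ x, ‖iteratedFDeriv ℝ k f x‖ ≤ A

section CBlemmas
variable {E : Type} [NormedAddCommGroup E] [NormedSpace ℝ E]
  {E' : Type} [NormedAddCommGroup E'] [NormedSpace ℝ E']

theorem CB.mono {A A' : ℝ} {f : E → ℝ} (h : CB A f) (hA : A ≤ A') : CB A' f :=
  ⟨h.cd, h.bd, fun k h1 h2 x => (h.der k h1 h2 x).trans hA⟩

theorem CB.nonneg {A : ℝ} {f : E → ℝ} (h : CB A f) : 0 ≤ A :=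
  (norm_nonneg _).trans (h.der 1 le_rfl (by norm_num) 0)

theorem CB.cdk {A : ℝ} {f : E → ℝ} (h : CB A f) (k : ℕ) (hk : k ≤ 3) : ContDiff ℝ k f :=
  h.cd.of_le (by exact_mod_cast hk)

theorem CB.const (c : ℝ) : CB 0 (fun _ : E => c) := by
  refine ⟨contDiff_const, ⟨|c|, fun _ => le_rfl⟩, fun k h1 h2 x => ?_⟩
  rw [iteratedFDeriv_const_of_ne (by omega)]; simp

theorem CB.add {A A' : ℝ} {f g : E → ℝ} (hf : CB A f) (hg : CB A' g) :
    CB (A + A') (fun x => f x + g x) := by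
  refine ⟨hf.cd.add hg.cd, ?_, fun k h1 h2 x => ?_⟩
  · obtain ⟨B, hB⟩ := hf.bd
    obtain ⟨B', hB'⟩ := hg.bd
    exact ⟨B + B', fun x => (abs_add_le _ _).trans (add_le_add (hB x) (hB' x))⟩
  · rw [fun_iteratedFDeriv_add_apply (hf.cdk k h2).contDiffAt (hg.cdk k h2).contDiffAt]
    exact (norm_add_le _ _).trans (add_le_add (hf.der k h1 h2 x) (hg.der k h1 h2 x))

theorem CB.smul {A : ℝ} {f : E → ℝ} (hf : CB A f) (c : ℝ) :
    CB (|c| * A) (fun x => c * f x) := by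
  refine ⟨contDiff_const.mul hf.cd, ?_, fun k h1 h2 x => ?_⟩
  · obtain ⟨B, hB⟩ := hf.bd
    refine ⟨|c| * B, fun x => ?_⟩
    rw [abs_mul]; exact mul_le_mul_of_nonneg_left (hB x) (abs_nonneg _)
  · have : (fun x => c * f x) = fun x => c • f x := rfl
    rw [this, iteratedFDeriv_const_smul_apply' (hf.cdk k h2).contDiffAt, norm_smul]
    exact mul_le_mul_of_nonneg_left (hf.der k h1 h2 x) (abs_nonneg _)

theorem CB.neg {A : ℝ} {f : E → ℝ} (hf : CB A f) : CB A (fun x => - f x) := by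
  have := hf.smul (-1)
  simpa using this

theorem CB.add_const {A : ℝ} {f : E → ℝ} (hf : CB A f) (c : ℝ) : CB A (fun x => f x + c) := by
  simpa using hf.add (CB.const c)

theorem CB.comp_lin {A : ℝ} {f : E → ℝ} (hf : CB A f) (g : E' →L[ℝ] E) (hg : ‖g‖ ≤ 1) :
    CB (A * ‖g‖) (fun x => f (g x)) := by
  refine ⟨hf.cd.comp g.contDiff, ?_, fun k h1 h2 x => ?_⟩
  · obtain ⟨B, hB⟩ := hf.bd
    exact ⟨B, fun x => hB _⟩
  · have h := g.iteratedFDeriv_comp_right (f := f) hf.cd x (i := k) (by exact_mod_cast h2)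
    have h' : (fun x => f (g x)) = f ∘ g := rfl
    rw [h', h]
    refine (ContinuousMultilinearMap.norm_compContinuousLinearMap_le _ _).trans ?_
    rw [Finset.prod_const, Finset.card_univ, Fintype.card_fin]
    refine mul_le_mul (hf.der k h1 h2 _) ?_ (by positivity) hf.nonneg
    exact pow_le_of_le_one (norm_nonneg _) hg (by omega)

theorem CB.comp_lin' {A : ℝ} {f : E → ℝ} (hf : CB A f) (g : E' →L[ℝ] E) (hg : ‖g‖ ≤ 1) :
    CB A (fun x => f (g x)) :=
  (hf.comp_lin g hg).mono (mul_le_of_le_one_right hf.nonneg hg)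

theorem CB.comp_add {A : ℝ} {f : E → ℝ} (hf : CB A f) (a : E) :
    CB A (fun x => f (x + a)) := by
  refine ⟨hf.cd.comp (contDiff_id.add contDiff_const), ?_, fun k h1 h2 x => ?_⟩
  · obtain ⟨B, hB⟩ := hf.bd
    exact ⟨B, fun x => hB _⟩
  · rw [iteratedFDeriv_comp_add_right]; exact hf.der k h1 h2 _

theorem CB.differentiable {A : ℝ} {f : E → ℝ} (hf : CB A f) : Differentiable ℝ f :=
  hf.cd.differentiable (by norm_num)

theorem CB.cd_fderiv {A : ℝ} {f : E → ℝ} (hf : CB A f) : ContDiff ℝ 2 (fderiv ℝ f) :=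
  hf.cd.fderiv_right (by norm_num)

theorem CB.cd_fderiv2 {A : ℝ} {f : E → ℝ} (hf : CB A f) :
    ContDiff ℝ 1 (fderiv ℝ (fderiv ℝ f)) :=
  hf.cd_fderiv.fderiv_right (by norm_num)

theorem CB.n1 {A : ℝ} {f : E → ℝ} (hf : CB A f) (x : E) : ‖fderiv ℝ f x‖ ≤ A := by
  rw [← norm_iteratedFDeriv_one]; exact hf.der 1 le_rfl (by norm_num) x

theorem CB.n2 {A : ℝ} {f : E → ℝ} (hf : CB A f) (x : E) :
    ‖fderiv ℝ (fderiv ℝ f) x‖ ≤ A := by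
  rw [← norm_iteratedFDeriv_one, norm_iteratedFDeriv_fderiv]
  exact hf.der 2 (by norm_num) (by norm_num) x

theorem CB.n3 {A : ℝ} {f : E → ℝ} (hf : CB A f) (x : E) :
    ‖fderiv ℝ (fderiv ℝ (fderiv ℝ f)) x‖ ≤ A := by
  rw [← norm_iteratedFDeriv_one, norm_iteratedFDeriv_fderiv, norm_iteratedFDeriv_fderiv]
  exact hf.der 3 (by norm_num) (by norm_num) x

theorem CB.continuous {A : ℝ} {f : E → ℝ} (hf : CB A f) : Continuous f := hf.cd.continuous

/-- First-order Taylor estimate with quadratic remainder. -/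
theorem taylor_quad {F : Type} [NormedAddCommGroup F] [NormedSpace ℝ F] {f : E → F} {A : ℝ}
    (hf : Differentiable ℝ f) (hf' : Differentiable ℝ (fderiv ℝ f))
    (hA : ∀ x, ‖fderiv ℝ (fderiv ℝ f) x‖ ≤ A) (x z : E) :
    ‖f (x + z) - f x - fderiv ℝ f x z‖ ≤ A * ‖z‖ ^ 2 := by
  have hA0 : 0 ≤ A := (norm_nonneg _).trans (hA 0)
  have hlip : ∀ y, ‖fderiv ℝ f y - fderiv ℝ f x‖ ≤ A * ‖y - x‖ := fun y =>
    convex_univ.norm_image_sub_le_of_norm_fderiv_le (fun w _ => hf' w) (fun w _ => hA w)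
      (mem_univ x) (mem_univ y)
  have h := (convex_segment (𝕜 := ℝ) x (x + z)).norm_image_sub_le_of_norm_fderiv_le'
    (f := f) (φ := fderiv ℝ f x) (C := A * ‖z‖) (fun w _ => hf w) (fun w hw => by
      refine (hlip w).trans (mul_le_mul_of_nonneg_left ?_ hA0)
      have := norm_sub_le_of_mem_segment hw
      simpa using this) (left_mem_segment ℝ _ _) (right_mem_segment ℝ _ _)
  have h2 : x + z - x = z := by abel
  rw [h2] at h
  calc _ ≤ _ := h
    _ = _ := by ring

/-- Second-order symmetric difference estimate. -/
theorem taylor_cub {f : E → ℝ} {A : ℝ} (hf : CB A f) (x σ : E) {s : ℝ} (hs : 0 ≤ s) :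
    |f (x + s • σ) + f (x + (-s) • σ) - 2 * f x - s ^ 2 * fderiv ℝ (fderiv ℝ f) x σ σ|
      ≤ 2 * A * ‖σ‖ ^ 3 * s ^ 3 := by
  have hA0 := hf.nonneg
  set q : ℝ → ℝ := fun r => f (x + r • σ) + f (x + (-r) • σ) - 2 * f x
    - r ^ 2 * fderiv ℝ (fderiv ℝ f) x σ σ with hq
  have hd : ∀ r, HasDerivAt q (fderiv ℝ f (x + r • σ) σ - fderiv ℝ f (x + (-r) • σ) σ
      - 2 * r * fderiv ℝ (fderiv ℝ f) x σ σ) r := by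
    intro r
    have e1 : HasDerivAt (fun r : ℝ => x + r • σ) σ r := by
      simpa using ((hasDerivAt_id r).smul_const σ).const_add x
    have e2 : HasDerivAt (fun r : ℝ => x + (-r) • σ) (-σ) r := by
      simpa using ((hasDerivAt_id r).neg.smul_const σ).const_add x
    have d1 := (hf.differentiable (x + r • σ)).hasFDerivAt.comp_hasDerivAt r e1
    have d2 := (hf.differentiable (x + (-r) • σ)).hasFDerivAt.comp_hasDerivAt r e2
    have d3 := ((hasDerivAt_id r).pow 2).mul_const (fderiv ℝ (fderiv ℝ f) x σ σ)
    have := ((d1.add d2).sub_const (2 * f x)).sub d3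
    refine this.congr_deriv ?_
    simp; ring
  have hT := taylor_quad (f := fderiv ℝ f) (A := A) (hf.cd_fderiv.differentiable (by norm_num))
    (hf.cd_fderiv2.differentiable (by norm_num)) hf.n3
  have hb : ∀ r ∈ Icc 0 s, ‖fderiv ℝ f (x + r • σ) σ - fderiv ℝ f (x + (-r) • σ) σ
      - 2 * r * fderiv ℝ (fderiv ℝ f) x σ σ‖ ≤ 2 * A * ‖σ‖ ^ 3 * s ^ 2 := by
    intro r hr
    have hrs : r ^ 2 ≤ s ^ 2 := pow_le_pow_left₀ hr.1 hr.2 2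
    have key : ∀ r' : ℝ, |r'| = r → ‖(fderiv ℝ f (x + r' • σ) - fderiv ℝ f x
        - fderiv ℝ (fderiv ℝ f) x (r' • σ)) σ‖ ≤ A * ‖σ‖ ^ 3 * s ^ 2 := by
      intro r' hr'
      refine (ContinuousLinearMap.le_opNorm _ _).trans ?_
      have h := hT x (r' • σ)
      rw [norm_smul, Real.norm_eq_abs, hr'] at h
      calc _ ≤ A * (r * ‖σ‖) ^ 2 * ‖σ‖ := mul_le_mul_of_nonneg_right h (norm_nonneg _)
        _ = A * ‖σ‖ ^ 3 * r ^ 2 := by ring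
        _ ≤ _ := mul_le_mul_of_nonneg_left hrs (by positivity)
    have k1 := key r (abs_of_nonneg hr.1)
    have k2 := key (-r) (by rw [abs_neg, abs_of_nonneg hr.1])
    have e : fderiv ℝ f (x + r • σ) σ - fderiv ℝ f (x + (-r) • σ) σ
      - 2 * r * fderiv ℝ (fderiv ℝ f) x σ σ
      = (fderiv ℝ f (x + r • σ) - fderiv ℝ f x
        - fderiv ℝ (fderiv ℝ f) x (r • σ)) σ - (fderiv ℝ f (x + (-r) • σ) - fderiv ℝ f x
        - fderiv ℝ (fderiv ℝ f) x ((-r) • σ)) σ := by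
      simp; ring
    rw [e]
    refine (norm_sub_le _ _).trans ?_
    linarith
  have := (convex_Icc (0 : ℝ) s).norm_image_sub_le_of_norm_hasDerivWithin_le (f := q)
    (fun r _ => (hd r).hasDerivWithinAt) hb (left_mem_Icc.2 hs) (right_mem_Icc.2 hs)
  have q0 : q 0 = 0 := by simp [hq]; ring
  rw [q0, sub_zero, sub_zero, Real.norm_eq_abs, Real.norm_of_nonneg hs] at this
  calc _ ≤ _ := this
    _ = _ := by ring

/-- Lipschitz estimate for `CB` functions. -/
theorem CB.lip {A : ℝ} {f : E → ℝ} (hf : CB A f) (x y : E) : |f x - f y| ≤ A * ‖x - y‖ :=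
  convex_univ.norm_image_sub_le_of_norm_fderiv_le (fun w _ => hf.differentiable w)
    (fun w _ => hf.n1 w) (mem_univ y) (mem_univ x)

/-- Smooth compactly supported functions are `CB`. -/
theorem CB.of_compact {f : E → ℝ} (hf : ContDiff ℝ 3 f) (hc : HasCompactSupport f) :
    ∃ A, CB A f := by
  have h : ∀ k : ℕ, k ≤ 3 → ∃ C, ∀ x, ‖iteratedFDeriv ℝ k f x‖ ≤ C := fun k hk =>
    (hf.continuous_iteratedFDeriv (by exact_mod_cast hk)).bounded_above_of_compact_support
      (hc.iteratedFDeriv k)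
  obtain ⟨C0, h0⟩ := h 0 (by norm_num)
  obtain ⟨C1, h1⟩ := h 1 (by norm_num)
  obtain ⟨C2, h2⟩ := h 2 (by norm_num)
  obtain ⟨C3, h3⟩ := h 3 (by norm_num)
  refine ⟨max C1 (max C2 C3), hf, ⟨C0, fun x => by simpa using h0 x⟩, fun k hk1 hk3 x => ?_⟩
  interval_cases k
  · exact (h1 x).trans (le_max_left _ _)
  · exact (h2 x).trans ((le_max_left _ _).trans (le_max_right _ _))
  · exact (h3 x).trans ((le_max_right _ _).trans (le_max_right _ _))

end CBlemmas

/-! ## Averages over translations -/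

/-- `Avg m f x = ∫ f(x+z) m(dz)`. -/
def Avg {E : Type} [NormedAddCommGroup E] [MeasurableSpace E]
    (m : Measure E) (f : E → ℝ) (x : E) : ℝ := ∫ z, f (x + z) ∂m

section AvgLemmas
variable {E : Type} [NormedAddCommGroup E] [NormedSpace ℝ E]
    [MeasurableSpace E] [BorelSpace E] [SecondCountableTopology E]

theorem integrable_of_cb (m : Measure E) [IsFiniteMeasure m] {f : E → ℝ} {C : ℝ}
    (hf : Continuous f) (hC : ∀ x, |f x| ≤ C) : Integrable f m :=
  (integrable_const C).mono' hf.aestronglyMeasurable (Eventually.of_forall hC)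

theorem integrable_shift (m : Measure E) [IsFiniteMeasure m] {f : E → ℝ} {C : ℝ}
    (hf : Continuous f) (hC : ∀ x, |f x| ≤ C) (x : E) : Integrable (fun z => f (x + z)) m :=
  integrable_of_cb m (by fun_prop) (fun z => hC (x + z))

theorem Avg_continuous (m : Measure E) [IsFiniteMeasure m] {f : E → ℝ} {C : ℝ}
    (hf : Continuous f) (hC : ∀ x, |f x| ≤ C) : Continuous (Avg m f) := by
  refine continuous_of_dominated (bound := fun _ => C) (fun x => ?_) (fun x => ?_)
    (integrable_const _) ?_
  · have : Continuous fun z => f (x + z) := by fun_prop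
    exact this.aestronglyMeasurable
  · exact Eventually.of_forall fun z => hC _
  · exact Eventually.of_forall fun z => by fun_prop

theorem Avg_bound (m : Measure E) [IsFiniteMeasure m] {f : E → ℝ} {C : ℝ}
    (hC : ∀ x, |f x| ≤ C) (x : E) : |Avg m f x| ≤ C * m.real univ := by
  rw [← Real.norm_eq_abs]
  exact norm_integral_le_of_norm_le_const (Eventually.of_forall fun z => hC (x + z))

theorem Avg_bound1 (m : Measure E) [IsProbabilityMeasure m] {f : E → ℝ} {C : ℝ}
    (hC : ∀ x, |f x| ≤ C) (x : E) : |Avg m f x| ≤ C := by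
  simpa using Avg_bound m hC x

theorem Avg_mono (m : Measure E) [IsFiniteMeasure m] {f g : E → ℝ} {C C' : ℝ}
    (hf : Continuous f) (hC : ∀ x, |f x| ≤ C) (hg : Continuous g) (hC' : ∀ x, |g x| ≤ C')
    (h : ∀ x, f x ≤ g x) (x : E) : Avg m f x ≤ Avg m g x :=
  integral_mono (integrable_shift m hf hC x) (integrable_shift m hg hC' x) fun z => h _

theorem Avg_add_const (m : Measure E) [IsProbabilityMeasure m] {f : E → ℝ} {C : ℝ}
    (hf : Continuous f) (hC : ∀ x, |f x| ≤ C) (c : ℝ) (x : E) :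
    Avg m (fun y => f y + c) x = Avg m f x + c := by
  unfold Avg
  rw [integral_add (integrable_shift m hf hC x) (integrable_const c)]
  simp

theorem Avg_add (m : Measure E) [IsFiniteMeasure m] {f g : E → ℝ} {C C' : ℝ}
    (hf : Continuous f) (hC : ∀ x, |f x| ≤ C) (hg : Continuous g) (hC' : ∀ x, |g x| ≤ C')
    (x : E) : Avg m (fun y => f y + g y) x = Avg m f x + Avg m g x :=
  integral_add (integrable_shift m hf hC x) (integrable_shift m hg hC' x)

theorem Avg_smul (m : Measure E) (f : E → ℝ) (c : ℝ) (x : E) :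
    Avg m (fun y => c * f y) x = c * Avg m f x :=
  integral_const_mul _ _

theorem Avg_shift (m : Measure E) (f : E → ℝ) (y x : E) :
    Avg m (fun x => f (x + y)) x = Avg m f (x + y) := by
  unfold Avg
  congr 1; funext z; rw [add_right_comm]

theorem Avg_conv (m μ : Measure E) [IsFiniteMeasure m] [IsFiniteMeasure μ] {f : E → ℝ} {C : ℝ}
    (hf : Continuous f) (hC : ∀ x, |f x| ≤ C) (x : E) :
    Avg (m ∗ μ) f x = Avg m (Avg μ f) x := by
  unfold Avg
  have hc : Continuous fun z => f (x + z) := by fun_prop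
  rw [Measure.conv, integral_map (by fun_prop) hc.aestronglyMeasurable,
    integral_prod]
  · congr 1; funext y; congr 1; funext z; rw [add_assoc]
  · exact (integrable_const C).mono' (by
      have : Continuous fun p : E × E => f (x + (p.1 + p.2)) := by fun_prop
      exact this.aestronglyMeasurable) (Eventually.of_forall fun p => hC _)

theorem CB.avg (m : Measure E) [IsFiniteMeasure m] {f : E → ℝ} {A : ℝ} (hf : CB A f) :
    CB (A * m.real univ) (Avg m f) := by
  obtain ⟨C, hC⟩ := hf.bd
  have h := param_contDiff m (fun _ => (1 : ℝ)) continuous_const 3 ℝ f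
    (fun k => if k = 0 then C * m.real univ else A * m.real univ) hf.cd (by
      intro k hk x₀
      refine ⟨fun _ => if k = 0 then C else A, integrable_const _, ?_, ?_⟩
      · rw [integral_const, smul_eq_mul]
        split_ifs <;> rw [mul_comm]
      · intro x _ q
        split_ifs with h0
        · subst h0; simpa using hC (x + q)
        · simpa using hf.der k (by omega) hk (x + q))
  simp only [one_smul] at h
  refine ⟨h.1, ⟨C * m.real univ, Avg_bound m hC⟩, fun k h1 h2 x => ?_⟩
  have := h.2 k h2 x
  rwa [if_neg (by omega)] at this

theorem CB.avg1 (m : Measure E) [IsProbabilityMeasure m] {f : E → ℝ} {A : ℝ} (hf : CB A f) :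
    CB A (Avg m f) := by
  simpa using hf.avg m

end AvgLemmas

theorem exists_mollifier (E : Type) [NormedAddCommGroup E] [NormedSpace ℝ E]
    [MeasureSpace E] [BorelSpace E] [FiniteDimensional ℝ E]
    [(volume : Measure E).IsAddHaarMeasure] {r : ℝ} (hr : 0 < r) :
    ∃ π : Measure E, IsProbabilityMeasure π ∧ (∀ᵐ q ∂π, ‖q‖ ≤ r) ∧
      ∃ A₀ : ℝ, 0 ≤ A₀ ∧ ∀ (f : E → ℝ) (C : ℝ), Continuous f → (∀ x, |f x| ≤ C) →
        CB (C * A₀) (Avg π f) := by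
  haveI : ProperSpace E := FiniteDimensional.proper ℝ E
  haveI : SecondCountableTopology E := inferInstance
  let φ : ContDiffBump (0 : E) := ⟨r / 2, r, by positivity, by linarith⟩
  set ρ : E → ℝ := φ.normed volume with hρ
  have hρc : Continuous ρ := φ.continuous_normed
  have hρ0 : ∀ x, 0 ≤ ρ x := fun x => φ.nonneg_normed x
  have hρs : HasCompactSupport ρ := φ.hasCompactSupport_normed
  have hρd : ContDiff ℝ 3 ρ := φ.contDiff_normed (n := 3)
  have hρi : Integrable ρ := φ.integrable_normed
  have hρ1 : ∫ x, ρ x = 1 := φ.integral_normed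
  have hts : tsupport ρ = Metric.closedBall 0 r := φ.tsupport_normed_eq
  set π : Measure E := volume.withDensity (fun q => ENNReal.ofReal (ρ q)) with hπ
  have hint : ∀ g : E → ℝ, ∫ q, g q ∂π = ∫ q, ρ q * g q := by
    intro g
    rw [hπ, integral_withDensity_eq_integral_toReal_smul (by fun_prop)
      (Eventually.of_forall fun _ => ENNReal.ofReal_lt_top)]
    congr 1; funext q; rw [ENNReal.toReal_ofReal (hρ0 q), smul_eq_mul]
  refine ⟨π, ⟨?_⟩, ?_, ?_⟩
  · rw [hπ, withDensity_apply _ MeasurableSet.univ, Measure.restrict_univ,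
      ← ofReal_integral_eq_lintegral_ofReal hρi (Eventually.of_forall hρ0), hρ1]
    simp
  · rw [hπ, ae_withDensity_iff (by fun_prop)]
    refine Eventually.of_forall fun q hq => ?_
    have : q ∈ tsupport ρ := subset_tsupport _ (by
      intro h0; apply hq; rw [h0]; simp)
    rw [hts] at this
    simpa using this
  · obtain ⟨M, hM⟩ : ∃ M, ∀ k ≤ 3, ∀ x, ‖iteratedFDeriv ℝ k ρ x‖ ≤ M := by
      obtain ⟨A, hA⟩ := CB.of_compact hρd hρs
      obtain ⟨B, hB⟩ := hA.bd
      refine ⟨max A B, fun k hk x => ?_⟩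
      rcases Nat.eq_zero_or_pos k with rfl | h
      · rw [norm_iteratedFDeriv_zero]; exact (hB x).trans (le_max_right _ _)
      · exact (hA.der k h hk x).trans (le_max_left _ _)
    have hM0 : 0 ≤ M := (norm_nonneg _).trans (hM 0 (by norm_num) 0)
    set vr : ℝ := (volume : Measure E).real (Metric.closedBall 0 (r + 1)) with hvr
    refine ⟨M * vr, by positivity, fun f C hf hC => ?_⟩
    have hC0 : 0 ≤ C := (abs_nonneg _).trans (hC 0)
    have heq : Avg π f = fun x => ∫ q, f (-q) • ρ (x + q) := by
      funext x
      unfold Avg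
      rw [hint, ← integral_neg_eq_self (fun q => f (-q) • ρ (x + q)),
        ← integral_add_left_eq_self (fun q => f (- -q) • ρ (x + -q)) x]
      congr 1; funext q
      have e : x + -(x + q) = -q := by abel
      have : ρ (-q) = ρ q := φ.normed_neg q
      rw [neg_neg, e, this, smul_eq_mul, mul_comm]
    have h := param_contDiff (volume : Measure E) (fun q => f (-q)) (by fun_prop) 3 ℝ ρ
      (fun _ => C * (M * vr)) hρd (by
        intro k hk x₀
        refine ⟨(Metric.closedBall (-x₀) (r + 1)).indicator (fun _ => C * M), ?_, ?_, ?_⟩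
        · rw [integrable_indicator_iff measurableSet_closedBall]
          exact integrableOn_const (isCompact_closedBall _ _).measure_lt_top.ne
        · rw [integral_indicator measurableSet_closedBall, setIntegral_const,
            Measure.real, Measure.addHaar_closedBall_center, smul_eq_mul]
          rw [hvr, Measure.real]
          exact le_of_eq (by ring)
        · intro x hx q
          by_cases hq : q ∈ Metric.closedBall (-x₀) (r + 1)
          · rw [indicator_of_mem hq]
            exact mul_le_mul (hC _) (hM k hk _) (norm_nonneg _) hC0
          · rw [indicator_of_notMem hq]
            have : iteratedFDeriv ℝ k ρ (x + q) = 0 := by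
              by_contra hne
              have hmem := support_iteratedFDeriv_subset (𝕜 := ℝ) k hne
              rw [hts, mem_closedBall_zero_iff] at hmem
              apply hq
              rw [mem_closedBall_iff_norm]
              rw [mem_ball_iff_norm] at hx
              have e : q - -x₀ = (x + q) - (x - x₀) := by abel
              rw [e]
              refine (norm_sub_le _ _).trans ?_
              linarith
            rw [this, norm_zero, mul_zero])
    rw [heq]
    refine ⟨h.1, ⟨C, fun x => ?_⟩, fun k h1 h2 x => h.2 k h2 x⟩
    have := congrFun heq x
    rw [← this]
    haveI : IsProbabilityMeasure π := ⟨by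
      rw [hπ, withDensity_apply _ MeasurableSet.univ, Measure.restrict_univ,
      ← ofReal_integral_eq_lintegral_ofReal hρi (Eventually.of_forall hρ0), hρ1]
      simp⟩
    exact Avg_bound1 π hC x

/-- Averaging over a small ball moves a Lipschitz function by little. -/
theorem Avg_near {E : Type} [NormedAddCommGroup E] [NormedSpace ℝ E]
    [MeasurableSpace E] [BorelSpace E] [SecondCountableTopology E]
    (π : Measure E) [IsProbabilityMeasure π] {r : ℝ} (hr : ∀ᵐ q ∂π, ‖q‖ ≤ r)
    {f : E → ℝ} {C K : ℝ} (hf : Continuous f) (hC : ∀ x, |f x| ≤ C) (hK : 0 ≤ K)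
    (hL : ∀ x y, |f x - f y| ≤ K * ‖x - y‖) (x : E) : |Avg π f x - f x| ≤ K * r := by
  have e : Avg π f x - f x = ∫ q, (f (x + q) - f x) ∂π := by
    rw [integral_sub (integrable_shift π hf hC x) (integrable_const _)]
    simp [Avg]
  rw [e, ← Real.norm_eq_abs]
  have := norm_integral_le_of_norm_le_const (μ := π) (f := fun q => f (x + q) - f x)
    (C := K * r) (by
      filter_upwards [hr] with q hq
      refine (hL _ _).trans (mul_le_mul_of_nonneg_left ?_ hK)
      simpa using hq)
  simpa using this

/-! ## The linear operators -/

/-- Lévy triplets. -/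
abbrev Trip (d : ℕ) : Type := Eu d × Matrix (Fin d) (Fin d) ℝ × Measure (Eu d)

/-- Basis vectors. -/
def eb {d : ℕ} (i : Fin d) : Eu d := EuclideanSpace.single i (1 : ℝ)

theorem eb_norm {d : ℕ} (i : Fin d) : ‖(eb i : Eu d)‖ = 1 := by simp [eb]

/-- The linear operator with triplet `θ`. -/
def Lop {d : ℕ} (θ : Trip d) (f : Eu d → ℝ) (x : Eu d) : ℝ :=
  fderiv ℝ f x θ.1 + (1 / 2) * (∑ i, ∑ j, fderiv ℝ (fderiv ℝ f) x (eb i) (eb j) * θ.2.1 j i)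
    + ∫ z, (f (x + z) - f x - fderiv ℝ f x (trunc z)) ∂θ.2.2

/-- Quantitative admissibility of a triplet. -/
structure Good {d : ℕ} (K : ℝ) (θ : Trip d) : Prop where
  psd : θ.2.1.PosSemidef
  int : Integrable (fun z : Eu d => min ‖z‖ (‖z‖ ^ 2)) θ.2.2
  intle : ∫ z, min ‖z‖ (‖z‖ ^ 2) ∂θ.2.2 ≤ K
  hb : ‖θ.1‖ ≤ K
  hc : ∑ i, ∑ j, |θ.2.1 j i| ≤ K

theorem min_nn {E : Type} [NormedAddCommGroup E] (z : E) : 0 ≤ min ‖z‖ (‖z‖ ^ 2) :=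
  le_min (norm_nonneg _) (by positivity)

theorem Good.nonneg {d : ℕ} {K : ℝ} {θ : Trip d} (h : Good K θ) : 0 ≤ K :=
  (norm_nonneg _).trans h.hb

theorem sum_ofReal_le {d : ℕ} (c : Fin d → Fin d → ℝ) {K : ℝ≥0}
    (h3 : ∑ i, ∑ j, ENNReal.ofReal |c i j| ≤ K) : ∑ i, ∑ j, |c i j| ≤ K := by
  have e : ∑ i, ∑ j, ENNReal.ofReal |c i j|
      = ENNReal.ofReal (∑ i, ∑ j, |c i j|) := by
    rw [ENNReal.ofReal_sum_of_nonneg (fun i _ => Finset.sum_nonneg fun j _ => abs_nonneg _)]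
    refine Finset.sum_congr rfl fun i _ => ?_
    rw [ENNReal.ofReal_sum_of_nonneg (fun j _ => abs_nonneg _)]
  rw [e] at h3
  have := ENNReal.toReal_mono ENNReal.coe_ne_top h3
  rw [ENNReal.toReal_ofReal
    (Finset.sum_nonneg fun i _ => Finset.sum_nonneg fun j _ => abs_nonneg _)] at this
  simpa using this

theorem good_of {d : ℕ} {Θ : Set (Trip d)} (htrip : IsLevyTripletSet Θ)
    (hK : HasUniformBound Θ) : ∃ K : ℝ, ∀ θ ∈ Θ, Good K θ := by
  obtain ⟨K, hK⟩ := hK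
  refine ⟨K, fun θ hθ => ?_⟩
  have h := hK θ hθ
  have h1 : (∫⁻ z, ENNReal.ofReal (min ‖z‖ (‖z‖ ^ 2)) ∂θ.2.2) ≤ K :=
    (le_self_add.trans le_self_add).trans h
  have h2 : ENNReal.ofReal ‖θ.1‖ ≤ K := (le_add_self.trans le_self_add).trans h
  have h3 : ∑ i, ∑ j, ENNReal.ofReal |θ.2.1 i j| ≤ K := le_add_self.trans h
  have hcont : Continuous (fun z : Eu d => min ‖z‖ (‖z‖ ^ 2)) := by fun_prop
  refine ⟨(htrip θ hθ).1, ⟨hcont.aestronglyMeasurable, ?_⟩, ?_, ?_, ?_⟩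
  · rw [hasFiniteIntegral_iff_ofReal (Eventually.of_forall fun z => min_nn z)]
    exact h1.trans_lt ENNReal.coe_lt_top
  · rw [integral_eq_lintegral_of_nonneg_ae (Eventually.of_forall fun z => min_nn z)
      hcont.aestronglyMeasurable]
    exact ENNReal.toReal_le_of_le_ofReal K.2 (by simpa using h1)
  · have := ENNReal.toReal_mono ENNReal.coe_ne_top h2
    simpa using this
  · have := sum_ofReal_le (fun i j => θ.2.1 i j) h3
    rw [Finset.sum_comm] at this
    exact this

theorem trunc_meas {d : ℕ} : Measurable (trunc : Eu d → Eu d) :=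
  Measurable.ite (measurableSet_le (by fun_prop) (by fun_prop)) measurable_id measurable_const

section LopLemmas
variable {d : ℕ} {K : ℝ} {θ : Trip d} {f g : Eu d → ℝ} {A A' : ℝ}

theorem integrand_bound (hf : CB A f) (x z : Eu d) :
    ‖f (x + z) - f x - fderiv ℝ f x (trunc z)‖ ≤ A * min ‖z‖ (‖z‖ ^ 2) := by
  have hA := hf.nonneg
  unfold trunc
  split_ifs with h
  · rw [min_eq_right (by nlinarith [norm_nonneg z])]
    exact taylor_quad hf.differentiable (hf.cd_fderiv.differentiable (by norm_num)) hf.n2 x z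
  · rw [min_eq_left (by nlinarith [norm_nonneg z])]
    have := hf.lip (x + z) x
    simpa using this

theorem integrand_integrable (hθ : Good K θ) (hf : CB A f) (x : Eu d) :
    Integrable (fun z => f (x + z) - f x - fderiv ℝ f x (trunc z)) θ.2.2 := by
  refine (hθ.int.const_mul A).mono' ?_ (Eventually.of_forall fun z => integrand_bound hf x z)
  have h1 : Continuous fun z => f (x + z) - f x := by have := hf.continuous; fun_prop
  have h2 : Measurable fun z => fderiv ℝ f x (trunc z) :=
    (fderiv ℝ f x).continuous.measurable.comp trunc_meas
  exact (h1.measurable.sub h2).aestronglyMeasurable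

theorem Lop_abs_le (hθ : Good K θ) (hf : CB A f) (x : Eu d) : |Lop θ f x| ≤ 3 * K * A := by
  have hA := hf.nonneg
  have hK := hθ.nonneg
  have h1 : |fderiv ℝ f x θ.1| ≤ A * K :=
    ((fderiv ℝ f x).le_opNorm θ.1).trans (mul_le_mul (hf.n1 x) hθ.hb (norm_nonneg _) hA)
  have h2 : |∑ i, ∑ j, fderiv ℝ (fderiv ℝ f) x (eb i) (eb j) * θ.2.1 j i| ≤ A * K := by
    calc _ ≤ ∑ i, ∑ j, A * |θ.2.1 j i| := by
          refine (Finset.abs_sum_le_sum_abs _ _).trans (Finset.sum_le_sum fun i _ => ?_)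
          refine (Finset.abs_sum_le_sum_abs _ _).trans (Finset.sum_le_sum fun j _ => ?_)
          rw [abs_mul]
          refine mul_le_mul_of_nonneg_right ?_ (abs_nonneg _)
          have := (fderiv ℝ (fderiv ℝ f) x).le_opNorm₂ (eb i) (eb j)
          rw [eb_norm, eb_norm, mul_one, mul_one] at this
          exact this.trans (hf.n2 x)
      _ = A * ∑ i, ∑ j, |θ.2.1 j i| := by simp_rw [Finset.mul_sum]
      _ ≤ _ := mul_le_mul_of_nonneg_left hθ.hc hA
  have h3 : |∫ z, (f (x + z) - f x - fderiv ℝ f x (trunc z)) ∂θ.2.2| ≤ A * K := by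
    calc _ ≤ ∫ z, A * min ‖z‖ (‖z‖ ^ 2) ∂θ.2.2 :=
          norm_integral_le_of_norm_le (hθ.int.const_mul A)
            (Eventually.of_forall fun z => integrand_bound hf x z)
      _ = A * ∫ z, min ‖z‖ (‖z‖ ^ 2) ∂θ.2.2 := integral_const_mul _ _
      _ ≤ _ := mul_le_mul_of_nonneg_left hθ.intle hA
  unfold Lop
  rw [abs_le] at *
  have : 0 ≤ A * K := mul_nonneg hA hK
  constructor <;> nlinarith

theorem Lop_add (hθ : Good K θ) (hf : CB A f) (hg : CB A' g) (x : Eu d) :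
    Lop θ (fun y => f y + g y) x = Lop θ f x + Lop θ g x := by
  have e1 : fderiv ℝ (fun y => f y + g y) = fun y => fderiv ℝ f y + fderiv ℝ g y := by
    funext y; exact fderiv_fun_add (hf.differentiable y) (hg.differentiable y)
  have e2 : fderiv ℝ (fun y => fderiv ℝ f y + fderiv ℝ g y) x
      = fderiv ℝ (fderiv ℝ f) x + fderiv ℝ (fderiv ℝ g) x :=
    fderiv_fun_add (hf.cd_fderiv.differentiable (by norm_num) x)
      (hg.cd_fderiv.differentiable (by norm_num) x)
  unfold Lop
  rw [e1, e2]
  have e3 : ∫ z, (f (x + z) + g (x + z) - (f x + g x)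
        - (fderiv ℝ f x + fderiv ℝ g x) (trunc z)) ∂θ.2.2
      = (∫ z, (f (x + z) - f x - fderiv ℝ f x (trunc z)) ∂θ.2.2)
        + ∫ z, (g (x + z) - g x - fderiv ℝ g x (trunc z)) ∂θ.2.2 := by
    rw [← integral_add (integrand_integrable hθ hf x) (integrand_integrable hθ hg x)]
    congr 1; funext z; simp only [_root_.add_apply]; ring
  rw [e3]
  simp only [_root_.add_apply, add_mul, Finset.sum_add_distrib]
  ring

theorem Lop_smul (hf : CB A f) (c : ℝ) (x : Eu d) :
    Lop θ (fun y => c * f y) x = c * Lop θ f x := by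
  have e1 : fderiv ℝ (fun y => c * f y) = fun y => c • fderiv ℝ f y := by
    funext y; exact fderiv_const_mul (hf.differentiable y) c
  have e2 : fderiv ℝ (fun y => c • fderiv ℝ f y) x = c • fderiv ℝ (fderiv ℝ f) x :=
    fderiv_fun_const_smul (hf.cd_fderiv.differentiable (by norm_num) x) c
  unfold Lop
  rw [e1, e2]
  have e3 : ∫ z, (c * f (x + z) - c * f x - (c • fderiv ℝ f x) (trunc z)) ∂θ.2.2
      = c * (∫ z, (f (x + z) - f x - fderiv ℝ f x (trunc z)) ∂θ.2.2) := by
    rw [← integral_const_mul]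
    congr 1; funext z; simp only [_root_.smul_apply, smul_eq_mul]; ring
  rw [e3]
  simp only [_root_.smul_apply, smul_eq_mul, mul_assoc, ← Finset.mul_sum]
  ring

theorem Lop_neg (hf : CB A f) (x : Eu d) :
    Lop θ (fun y => - f y) x = - Lop θ f x := by
  have := Lop_smul (θ := θ) hf (-1) x
  simpa using this

theorem Lop_add_const (hθ : Good K θ) (hf : CB A f) (c : ℝ) (x : Eu d) :
    Lop θ (fun y => f y + c) x = Lop θ f x := by
  rw [Lop_add hθ hf (CB.const c)]
  have := Lop_abs_le hθ (CB.const (E := Eu d) c) x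
  rw [mul_zero] at this
  rw [abs_nonpos_iff.mp this, add_zero]

theorem Gop_eq (Θ : Set (Trip d)) (hf : CB A f) (x : Eu d) :
    Gop Θ (gradient f x) (hessMatrix f x) (fun z => f (x + z))
      = sSup {r | ∃ θ ∈ Θ, r = Lop θ f x} := by
  unfold Gop
  congr 1
  ext r
  refine exists_congr fun θ => and_congr_right fun _ => ?_
  have e1 : ∑ i, (gradient f x) i * θ.1 i = fderiv ℝ f x θ.1 := by
    have := InnerProductSpace.toDual_symm_apply (𝕜 := ℝ) (x := θ.1) (y := fderiv ℝ f x)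
    rw [← this, PiLp.inner_apply]
    refine Finset.sum_congr rfl fun i _ => ?_
    simp [gradient, mul_comm]
  have e2 : (hessMatrix f x * θ.2.1).trace
      = ∑ i, ∑ j, fderiv ℝ (fderiv ℝ f) x (eb i) (eb j) * θ.2.1 j i := by
    simp only [Matrix.trace, Matrix.diag, Matrix.mul_apply, hessMatrix, Matrix.of_apply,
      iteratedFDeriv_two_apply]
    rfl
  rw [e1, e2]
  have e3 : fderiv ℝ (fun z => f (x + z)) 0 = fderiv ℝ f x := by
    rw [fderiv_comp_add_left]; simp
  rw [e3]
  simp only [add_zero]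
  rfl

theorem Gop_le {Θ : Set (Trip d)} (hne : Θ.Nonempty) (hf : CB A f) (x : Eu d) {r : ℝ}
    (h : ∀ θ ∈ Θ, Lop θ f x ≤ r) :
    Gop Θ (gradient f x) (hessMatrix f x) (fun z => f (x + z)) ≤ r := by
  rw [Gop_eq Θ hf x]
  obtain ⟨θ, hθ⟩ := hne
  refine csSup_le ⟨_, θ, hθ, rfl⟩ ?_
  rintro _ ⟨θ, hθ, rfl⟩
  exact h θ hθ

theorem le_Gop {Θ : Set (Trip d)} (hG : ∀ θ ∈ Θ, Good K θ) (hf : CB A f) (x : Eu d)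
    (hθ : θ ∈ Θ) :
    Lop θ f x ≤ Gop Θ (gradient f x) (hessMatrix f x) (fun z => f (x + z)) := by
  rw [Gop_eq Θ hf x]
  refine le_csSup ⟨3 * K * A, ?_⟩ ⟨θ, hθ, rfl⟩
  rintro _ ⟨θ, hθ, rfl⟩
  exact (abs_le.mp (Lop_abs_le (hG θ hθ) hf x)).2

end LopLemmas

/-! ## Approximation of the linear operators by bounded jump operators -/

/-- The bounded jump operator. -/
def Jop {d : ℕ} (ν : Measure (Eu d)) (f : Eu d → ℝ) (x : Eu d) : ℝ := ∫ z, (f (x + z) - f x) ∂ν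

section Appr
variable {d : ℕ} {K : ℝ} {θ : Trip d} {f g : Eu d → ℝ} {A A' : ℝ}

theorem Jop_integrable (ν : Measure (Eu d)) [IsFiniteMeasure ν] (hf : CB A f) (x : Eu d) :
    Integrable (fun z => f (x + z) - f x) ν := by
  obtain ⟨B, hB⟩ := hf.bd
  exact (integrable_shift ν hf.continuous hB x).sub (integrable_const _)

theorem Jop_add_measure (ν ν' : Measure (Eu d)) [IsFiniteMeasure ν] [IsFiniteMeasure ν']
    (hf : CB A f) (x : Eu d) : Jop (ν + ν') f x = Jop ν f x + Jop ν' f x :=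
  integral_add_measure (Jop_integrable ν hf x) (Jop_integrable ν' hf x)

theorem Jop_dirac (c : ℝ≥0) (y : Eu d) (f : Eu d → ℝ) (x : Eu d) :
    Jop (c • Measure.dirac y) f x = c * (f (x + y) - f x) := by
  unfold Jop
  rw [integral_smul_nnreal_measure, integral_dirac]; rfl

/-- An operator which can be approximated by bounded jump operators. -/
def Appr (T : (Eu d → ℝ) → Eu d → ℝ) : Prop :=
  ∀ ε : ℝ, 0 < ε → ∃ ν : Measure (Eu d), IsFiniteMeasure ν ∧
    ∀ A f, CB A f → ∀ x, |T f x - Jop ν f x| ≤ ε * A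

theorem Appr.add {T T' : (Eu d → ℝ) → Eu d → ℝ} (h : Appr T) (h' : Appr T') :
    Appr (fun f x => T f x + T' f x) := by
  intro ε hε
  obtain ⟨ν, hν, h⟩ := h (ε / 2) (by positivity)
  obtain ⟨ν', hν', h'⟩ := h' (ε / 2) (by positivity)
  refine ⟨ν + ν', inferInstance, fun A f hf x => ?_⟩
  rw [Jop_add_measure ν ν' hf]
  have h1 := h A f hf x
  have h2 := h' A f hf x
  rw [abs_le] at *
  constructor <;> linarith

theorem Appr.zero : Appr (fun (_ : Eu d → ℝ) (_ : Eu d) => (0 : ℝ)) := by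
  intro ε hε
  refine ⟨0, inferInstance, fun A f hf x => ?_⟩
  have := hf.nonneg
  simp only [Jop, integral_zero_measure, sub_zero, abs_zero]
  positivity

theorem Appr.drift (b : Eu d) : Appr (fun f x => fderiv ℝ f x b) := by
  intro ε hε
  set h : ℝ := ε / (‖b‖ ^ 2 + 1) with hh
  have hpos : 0 < h := by positivity
  have hle : h * ‖b‖ ^ 2 ≤ ε := by
    rw [hh, div_mul_eq_mul_div, div_le_iff₀ (by positivity)]
    nlinarith [sq_nonneg ‖b‖]
  refine ⟨(1 / h).toNNReal • Measure.dirac (h • b), inferInstance,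
    fun A f hf x => ?_⟩
  rw [Jop_dirac]
  have hA := hf.nonneg
  have h1 := taylor_quad hf.differentiable (hf.cd_fderiv.differentiable (by norm_num)) hf.n2 x
    (h • b)
  rw [map_smul, norm_smul, Real.norm_eq_abs, Real.norm_eq_abs, abs_of_pos hpos, smul_eq_mul] at h1
  have e : fderiv ℝ f x b - 1 / h * (f (x + h • b) - f x)
      = - (1 / h) * (f (x + h • b) - f x - h * fderiv ℝ f x b) := by field_simp; ring
  rw [Real.coe_toNNReal _ (by positivity)]
  rw [e, abs_mul, abs_neg, abs_of_pos (by positivity : 0 < 1 / h), div_mul_eq_mul_div, one_mul,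
    div_le_iff₀ hpos]
  refine h1.trans ?_
  calc A * (h * ‖b‖) ^ 2 = (h * ‖b‖ ^ 2) * (A * h) := by ring
    _ ≤ ε * (A * h) := by gcongr
    _ = ε * A * h := by ring

theorem Appr.diff (σ : Eu d) : Appr (fun f x => 1 / 2 * fderiv ℝ (fderiv ℝ f) x σ σ) := by
  intro ε hε
  set h : ℝ := ε / (‖σ‖ ^ 3 + 1) with hh
  have hpos : 0 < h := by positivity
  have hle : h * ‖σ‖ ^ 3 ≤ ε := by
    rw [hh, div_mul_eq_mul_div, div_le_iff₀ (by positivity)]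
    nlinarith [pow_nonneg (norm_nonneg σ) 3]
  set c : ℝ≥0 := (1 / (2 * h ^ 2)).toNNReal with hc
  refine ⟨c • Measure.dirac (h • σ) + c • Measure.dirac ((-h) • σ), inferInstance,
    fun A f hf x => ?_⟩
  rw [Jop_add_measure _ _ hf, Jop_dirac, Jop_dirac]
  have hA := hf.nonneg
  have h1 := taylor_cub hf x σ hpos.le
  have e : 1 / 2 * fderiv ℝ (fderiv ℝ f) x σ σ - (1 / (2 * h ^ 2) * (f (x + h • σ) - f x)
      + 1 / (2 * h ^ 2) * (f (x + (-h) • σ) - f x))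
      = - (1 / (2 * h ^ 2)) * (f (x + h • σ) + f (x + (-h) • σ) - 2 * f x
        - h ^ 2 * fderiv ℝ (fderiv ℝ f) x σ σ) := by field_simp; ring
  rw [hc, Real.coe_toNNReal _ (by positivity)]
  rw [e, abs_mul, abs_neg, abs_of_pos (by positivity : 0 < 1 / (2 * h ^ 2)), div_mul_eq_mul_div,
    one_mul, div_le_iff₀ (by positivity)]
  refine h1.trans ?_
  calc 2 * A * ‖σ‖ ^ 3 * h ^ 3 = (h * ‖σ‖ ^ 3) * (2 * A * h ^ 2) := by ring
    _ ≤ ε * (2 * A * h ^ 2) := by gcongr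
    _ = ε * A * (2 * h ^ 2) := by ring

theorem Appr.sum {m : ℕ} (T : Fin m → (Eu d → ℝ) → Eu d → ℝ) (hT : ∀ k, Appr (T k))
    (s : Finset (Fin m)) : Appr (fun f x => ∑ k ∈ s, T k f x) := by
  induction s using Finset.induction_on with
  | empty => simpa using Appr.zero
  | insert a s ha ih => 
    simp only [Finset.sum_insert ha]
    exact (hT a).add ih

theorem small_jumps (hθ : Good K θ) {ε : ℝ} (hε : 0 < ε) : ∃ η : ℝ, 0 < η ∧
    ∫ z in {z : Eu d | ‖z‖ ≤ η}, min ‖z‖ (‖z‖ ^ 2) ∂θ.2.2 ≤ ε := by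
  have h := tendsto_setIntegral_of_antitone (μ := θ.2.2)
    (f := fun z : Eu d => min ‖z‖ (‖z‖ ^ 2))
    (s := fun n : ℕ => {z : Eu d | ‖z‖ ≤ 1 / ((n : ℝ) + 1)})
    (fun i => measurableSet_le (by fun_prop) (by fun_prop))
    (fun i j hij z hz => le_trans (show ‖z‖ ≤ _ from hz) (by
      apply one_div_le_one_div_of_le (by positivity)
      have : (i : ℝ) ≤ j := by exact_mod_cast hij
      linarith))
    ⟨0, hθ.int.integrableOn⟩
  have e : (⋂ n : ℕ, {z : Eu d | ‖z‖ ≤ 1 / ((n : ℝ) + 1)}) = {0} := by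
    ext z
    simp only [mem_iInter, mem_ofPred_eq, mem_singleton_iff]
    constructor
    · intro hz
      have : ‖z‖ ≤ 0 := ge_of_tendsto' tendsto_one_div_add_atTop_nhds_zero_nat hz
      exact norm_le_zero_iff.mp this
    · rintro rfl n; simp; positivity
  rw [e] at h
  have e0 : ∫ z in ({0} : Set (Eu d)), min ‖z‖ (‖z‖ ^ 2) ∂θ.2.2 = 0 := by
    rw [setIntegral_congr_fun (g := fun _ => (0 : ℝ)) (measurableSet_singleton 0)]
    · simp
    · intro z hz; rw [mem_singleton_iff.mp hz]; simp
  rw [e0] at h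
  obtain ⟨n, hn⟩ := (h.eventually (eventually_lt_nhds hε)).exists
  exact ⟨1 / ((n : ℝ) + 1), by positivity, hn.le⟩

theorem psd_sum {c : Matrix (Fin d) (Fin d) ℝ} (hc : c.PosSemidef) :
    ∃ (m : ℕ) (σ : Fin m → Eu d), ∀ B : Eu d →L[ℝ] Eu d →L[ℝ] ℝ,
      ∑ i, ∑ j, B (eb i) (eb j) * c j i = ∑ k, B (σ k) (σ k) := by
  obtain ⟨m, v, hv⟩ := Matrix.posSemidef_iff_eq_sum_vecMulVec.mp hc
  refine ⟨m, fun k => WithLp.toLp 2 (v k), fun B => ?_⟩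
  have e : ∀ k, (WithLp.toLp 2 (v k) : Eu d) = ∑ i, v k i • eb i := by
    intro k
    ext j
    simp [eb, Finset.sum_apply, Pi.single_apply]
  have e2 : ∀ k, B (WithLp.toLp 2 (v k)) (WithLp.toLp 2 (v k))
      = ∑ i, ∑ j, B (eb i) (eb j) * (v k j * v k i) := by
    intro k
    rw [e k]
    simp only [map_sum, map_smul, _root_.sum_apply, _root_.smul_apply, smul_eq_mul,
      Finset.mul_sum]
    rw [Finset.sum_comm]
    refine Finset.sum_congr rfl fun i _ => Finset.sum_congr rfl fun j _ => ?_
    ring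
  simp_rw [e2]
  rw [Finset.sum_comm (s := (Finset.univ : Finset (Fin m)))]
  refine Finset.sum_congr rfl fun i _ => ?_
  rw [Finset.sum_comm (s := (Finset.univ : Finset (Fin m)))]
  refine Finset.sum_congr rfl fun j _ => ?_
  rw [hv, ← Finset.mul_sum, Matrix.sum_apply]
  simp [Matrix.vecMulVec_apply]

theorem exists_approx (hθ : Good K θ) {ε : ℝ} (hε : 0 < ε) :
    ∃ ν : Measure (Eu d), IsFiniteMeasure ν ∧
      ∀ A f, CB A f → ∀ x, |Lop θ f x - Jop ν f x| ≤ ε * A := by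
  obtain ⟨η, hη, hsm⟩ := small_jumps hθ (half_pos hε)
  obtain ⟨m, σ, hσ⟩ := psd_sum hθ.psd
  set S : Set (Eu d) := {z | ‖z‖ ≤ η} with hS
  have hSm : MeasurableSet S := measurableSet_le (by fun_prop) (by fun_prop)
  have hfin : θ.2.2 Sᶜ < ⊤ := by
    refine (measure_mono ?_).trans_lt
      (hθ.int.measure_norm_ge_lt_top (ε := min η (η ^ 2)) (by positivity))
    intro z hz
    have hz : η < ‖z‖ := not_le.mp hz
    simp only [mem_ofPred_eq]
    rw [Real.norm_of_nonneg (min_nn z)]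
    exact min_le_min hz.le (by gcongr)
  set F := θ.2.2.restrict Sᶜ with hF
  haveI : IsFiniteMeasure F := ⟨by rw [hF, Measure.restrict_apply_univ]; exact hfin⟩
  have htr : Integrable (fun z : Eu d => trunc z) F := by
    refine (integrable_const (1 : ℝ)).mono' trunc_meas.aestronglyMeasurable
      (Eventually.of_forall fun z => ?_)
    unfold trunc; split_ifs with h
    · exact h
    · simp
  set b : Eu d := θ.1 - ∫ z, trunc z ∂F with hb
  obtain ⟨ν, hν, hνa⟩ := ((Appr.drift b).add (Appr.sum _ (fun k => Appr.diff (σ k)) Finset.univ))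
    (ε / 2) (half_pos hε)
  refine ⟨ν + F, inferInstance, fun A f hf x => ?_⟩
  have h1 := hνa A f hf x
  rw [Jop_add_measure _ _ hf]
  have hA := hf.nonneg
  have e : Lop θ f x = (fderiv ℝ f x b + ∑ k, 1 / 2 * fderiv ℝ (fderiv ℝ f) x (σ k) (σ k))
      + Jop F f x + ∫ z in S, (f (x + z) - f x - fderiv ℝ f x (trunc z)) ∂θ.2.2 := by
    unfold Lop
    rw [hσ, ← integral_add_compl hSm (integrand_integrable hθ hf x), Finset.mul_sum]
    have e1 : ∫ z in Sᶜ, (f (x + z) - f x - fderiv ℝ f x (trunc z)) ∂θ.2.2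
        = Jop F f x - fderiv ℝ f x (∫ z, trunc z ∂F) := by
      rw [integral_sub (Jop_integrable F hf x) ((fderiv ℝ f x).integrable_comp htr),
        ContinuousLinearMap.integral_comp_comm _ htr]
      rfl
    rw [e1, hb, map_sub]
    ring
  have h2 : |∫ z in S, (f (x + z) - f x - fderiv ℝ f x (trunc z)) ∂θ.2.2| ≤ ε / 2 * A := by
    calc _ ≤ ∫ z in S, A * min ‖z‖ (‖z‖ ^ 2) ∂θ.2.2 :=
          norm_integral_le_of_norm_le (hθ.int.const_mul A).integrableOn
            (Eventually.of_forall fun z => integrand_bound hf x z)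
      _ = A * ∫ z in S, min ‖z‖ (‖z‖ ^ 2) ∂θ.2.2 := integral_const_mul _ _
      _ ≤ A * (ε / 2) := mul_le_mul_of_nonneg_left hsm hA
      _ = _ := by ring
  rw [e]
  rw [abs_le] at *
  constructor <;> linarith

end Appr

/-! ## Test functions -/

/-- Time functions with bounded derivatives on `[0,∞)`. -/
structure TB (τ : ℝ → ℝ) : Prop where
  cd : ContDiff ℝ 2 τ
  bd : ∃ C, ∀ t, 0 ≤ t → |τ t| ≤ C ∧ |deriv τ t| ≤ C ∧ |deriv (deriv τ) t| ≤ C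

theorem TB.diff {τ : ℝ → ℝ} (h : TB τ) : Differentiable ℝ τ := h.cd.differentiable (by norm_num)

theorem TB.ddiff {τ : ℝ → ℝ} (h : TB τ) : Differentiable ℝ (deriv τ) :=
  (((contDiff_succ_iff_deriv (n := 1)).mp h.cd).2.2).differentiable (by norm_num)

theorem TB.const (c : ℝ) : TB (fun _ => c) := by
  refine ⟨contDiff_const, |c|, fun t _ => ?_⟩
  simp

theorem TB.add {τ σ : ℝ → ℝ} (h : TB τ) (h' : TB σ) : TB (fun t => τ t + σ t) := by
  obtain ⟨C, hC⟩ := h.bd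
  obtain ⟨C', hC'⟩ := h'.bd
  have e1 : deriv (fun t => τ t + σ t) = fun t => deriv τ t + deriv σ t := by
    funext t; exact deriv_fun_add (h.diff t) (h'.diff t)
  refine ⟨h.cd.add h'.cd, C + C', fun t ht => ?_⟩
  rw [e1, deriv_fun_add (h.ddiff t) (h'.ddiff t)]
  obtain ⟨a1, a2, a3⟩ := hC t ht
  obtain ⟨b1, b2, b3⟩ := hC' t ht
  exact ⟨(abs_add_le _ _).trans (add_le_add a1 b1), (abs_add_le _ _).trans (add_le_add a2 b2),
    (abs_add_le _ _).trans (add_le_add a3 b3)⟩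

theorem TB.smul {τ : ℝ → ℝ} (h : TB τ) (c : ℝ) : TB (fun t => c * τ t) := by
  obtain ⟨C, hC⟩ := h.bd
  have e1 : deriv (fun t => c * τ t) = fun t => c * deriv τ t := by
    funext t; exact deriv_const_mul_field c
  refine ⟨contDiff_const.mul h.cd, |c| * C, fun t ht => ?_⟩
  rw [e1, deriv_const_mul_field]
  simp only [abs_mul]
  obtain ⟨a1, a2, a3⟩ := hC t ht
  exact ⟨by gcongr, by gcongr, by gcongr⟩

theorem TB.of_compact {τ : ℝ → ℝ} (h : ContDiff ℝ 2 τ) (hc : HasCompactSupport (deriv τ))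
    {B : ℝ} (hB : ∀ t, |τ t| ≤ B) : TB τ := by
  have h1 : ContDiff ℝ 1 (deriv τ) := ((contDiff_succ_iff_deriv (n := 1)).mp h).2.2
  have h2 : Continuous (deriv (deriv τ)) := h1.continuous_deriv (by norm_num)
  obtain ⟨C1, hC1⟩ := h1.continuous.bounded_above_of_compact_support hc
  obtain ⟨C2, hC2⟩ := h2.bounded_above_of_compact_support hc.deriv
  refine ⟨h, max B (max C1 C2), fun t _ => ⟨(hB t).trans (le_max_left _ _),
    (hC1 t).trans ((le_max_left _ _).trans (le_max_right _ _)),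
    (hC2 t).trans ((le_max_right _ _).trans (le_max_right _ _))⟩⟩

theorem hasDerivAt_expo (t0 t : ℝ) :
    HasDerivAt (fun t => 1 - Real.exp (-(t - t0))) (Real.exp (-(t - t0))) t := by
  have h1 : HasDerivAt (fun t : ℝ => -(t - t0)) (-1) t := ((hasDerivAt_id t).sub_const t0).neg
  have := (h1.exp).const_sub 1
  simpa using this

theorem TB.expo (t0 : ℝ) : TB (fun t => 1 - Real.exp (-(t - t0))) := by
  have e1 : deriv (fun t => 1 - Real.exp (-(t - t0))) = fun t => Real.exp (-(t - t0)) := by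
    funext t; exact (hasDerivAt_expo t0 t).deriv
  have e2 : deriv (fun t => Real.exp (-(t - t0))) = fun t => - Real.exp (-(t - t0)) := by
    funext t
    have h1 : HasDerivAt (fun t : ℝ => -(t - t0)) (-1) t := ((hasDerivAt_id t).sub_const t0).neg
    have := (h1.exp).deriv
    simpa using this
  refine ⟨by fun_prop, 1 + Real.exp t0, fun t ht => ?_⟩
  rw [e1, e2]
  have h1 : Real.exp (-(t - t0)) ≤ Real.exp t0 := Real.exp_le_exp.mpr (by linarith)
  have h2 := Real.exp_pos (-(t - t0))
  simp only [abs_neg, abs_of_pos h2]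
  refine ⟨?_, by linarith, by linarith⟩
  rw [abs_le]; constructor <;> linarith

theorem TB.step {t1 T : ℝ} (h : t1 < T) :
    TB (fun t => Real.smoothTransition ((t - t1) / (T - t1))) := by
  have hpos : 0 < T - t1 := sub_pos.mpr h
  refine TB.of_compact ?_ ?_ (B := 1) ?_
  · exact (Real.smoothTransition.contDiff (n := 2)).comp (by fun_prop)
  · refine HasCompactSupport.of_support_subset_isCompact (isCompact_Icc (a := t1) (b := T)) ?_
    intro t ht
    by_contra hcon
    apply ht
    rw [mem_Icc, not_and_or, not_le, not_le] at hcon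
    rcases hcon with hlt | hgt
    · have : (fun t => Real.smoothTransition ((t - t1) / (T - t1))) =ᶠ[𝓝 t] fun _ => 0 := by
        filter_upwards [eventually_lt_nhds hlt] with s hs
        exact Real.smoothTransition.zero_of_nonpos
          (div_nonpos_of_nonpos_of_nonneg (by linarith) hpos.le)
      rw [this.deriv_eq]; simp
    · have : (fun t => Real.smoothTransition ((t - t1) / (T - t1))) =ᶠ[𝓝 t] fun _ => 1 := by
        filter_upwards [eventually_gt_nhds hgt] with s hs
        exact Real.smoothTransition.one_of_one_le
          ((one_le_div hpos).mpr (by linarith))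
      rw [this.deriv_eq]; simp
  · intro t
    rw [abs_of_nonneg (Real.smoothTransition.nonneg _)]
    exact Real.smoothTransition.le_one _

theorem step_deriv_nonneg {t1 T : ℝ} (h : t1 < T) (t : ℝ) :
    0 ≤ deriv (fun t => Real.smoothTransition ((t - t1) / (T - t1))) t := by
  have hpos : 0 < T - t1 := sub_pos.mpr h
  refine Monotone.deriv_nonneg ?_
  intro a b hab
  exact Real.smoothTransition.monotone (by gcongr)

/-- A convenient class of test functions. -/
structure TF {d : ℕ} (φ : ℝ → Eu d → ℝ) : Prop where
  cont : Continuous (fun p : ℝ × Eu d => φ p.1 p.2)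
  tcd : ∀ x, ContDiff ℝ 2 (fun t => φ t x)
  xcb : ∃ A, ∀ t, 0 ≤ t → CB A (φ t)
  bd : ∃ C, ∀ t, 0 ≤ t → ∀ x, |φ t x| ≤ C ∧ |deriv (fun s => φ s x) t| ≤ C ∧
    |deriv (deriv (fun s => φ s x)) t| ≤ C

section TFs
variable {d : ℕ}

theorem TF.isC23b {φ : ℝ → Eu d → ℝ} (h : TF φ) : IsC23b φ := by
  obtain ⟨A, hA⟩ := h.xcb
  obtain ⟨C, hC⟩ := h.bd
  refine ⟨h.cont.continuousOn, fun x => (h.tcd x).contDiffOn, fun t ht => (hA t (le_of_lt ht)).cd,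
    max A C, fun t ht x => ?_⟩
  have ht : 0 ≤ t := le_of_lt ht
  obtain ⟨c1, c2, c3⟩ := hC t ht x
  have hr := le_max_right A C
  have hl := le_max_left A C
  exact ⟨c1.trans hr, c2.trans hr, c3.trans hr, ((hA t ht).n1 x).trans hl,
    ((hA t ht).der 2 (by norm_num) (by norm_num) x).trans hl,
    ((hA t ht).der 3 (by norm_num) (by norm_num) x).trans hl⟩

theorem TF.tb {φ : ℝ → Eu d → ℝ} (h : TF φ) (x : Eu d) : TB (fun t => φ t x) := by
  obtain ⟨C, hC⟩ := h.bd
  exact ⟨h.tcd x, C, fun t ht => hC t ht x⟩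

theorem TF.add {φ ψ : ℝ → Eu d → ℝ} (h : TF φ) (h' : TF ψ) :
    TF (fun t x => φ t x + ψ t x) := by
  obtain ⟨A, hA⟩ := h.xcb
  obtain ⟨C, hC⟩ := h.bd
  obtain ⟨A', hA'⟩ := h'.xcb
  obtain ⟨C', hC'⟩ := h'.bd
  refine ⟨h.cont.add h'.cont, fun x => (h.tcd x).add (h'.tcd x),
    ⟨A + A', fun t ht => (hA t ht).add (hA' t ht)⟩, C + C', fun t ht x => ?_⟩
  have e1 : deriv (fun s => φ s x + ψ s x)
      = fun t => deriv (fun s => φ s x) t + deriv (fun s => ψ s x) t := by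
    funext t; exact deriv_fun_add ((h.tb x).diff t) ((h'.tb x).diff t)
  rw [e1, deriv_fun_add ((h.tb x).ddiff t) ((h'.tb x).ddiff t)]
  obtain ⟨a1, a2, a3⟩ := hC t ht x
  obtain ⟨b1, b2, b3⟩ := hC' t ht x
  exact ⟨(abs_add_le _ _).trans (add_le_add a1 b1), (abs_add_le _ _).trans (add_le_add a2 b2),
    (abs_add_le _ _).trans (add_le_add a3 b3)⟩

theorem TF.deriv_add {φ ψ : ℝ → Eu d → ℝ} (h : TF φ) (h' : TF ψ) (t : ℝ) (x : Eu d) :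
    deriv (fun s => φ s x + ψ s x) t = deriv (fun s => φ s x) t + deriv (fun s => ψ s x) t :=
  deriv_fun_add ((h.tb x).diff t) ((h'.tb x).diff t)

theorem TF.mul {τ : ℝ → ℝ} (h : TB τ) {k : Eu d → ℝ} {A : ℝ} (hk : CB A k) :
    TF (fun t x => τ t * k x) := by
  obtain ⟨C, hC⟩ := h.bd
  obtain ⟨B, hB⟩ := hk.bd
  have hA := hk.nonneg
  have hC0 : 0 ≤ C := (abs_nonneg _).trans (hC 0 le_rfl).1
  have hB0 : 0 ≤ B := (abs_nonneg _).trans (hB 0)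
  refine ⟨?_, fun x => h.cd.mul contDiff_const,
    ⟨C * A, fun t ht => (hk.smul (τ t)).mono (mul_le_mul_of_nonneg_right (hC t ht).1 hA)⟩,
    C * B, fun t ht x => ?_⟩
  · have := hk.continuous
    have := h.cd.continuous
    fun_prop
  · have e1 : deriv (fun s => τ s * k x) = fun t => deriv τ t * k x := by
      funext t; exact deriv_mul_const_field _
    rw [e1, deriv_mul_const_field]
    simp only [abs_mul]
    obtain ⟨a1, a2, a3⟩ := hC t ht
    have := hB x
    exact ⟨by gcongr, by gcongr, by gcongr⟩

theorem TF.space {k : Eu d → ℝ} {A : ℝ} (hk : CB A k) : TF (fun _ x => k x) := by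
  simpa using TF.mul (TB.const 1) hk

theorem TF.time {τ : ℝ → ℝ} (h : TB τ) : TF (fun t (_ : Eu d) => τ t) := by
  simpa using TF.mul h (CB.const (E := Eu d) 1)

theorem TF.joint {A : ℝ} {W : ℝ × Eu d → ℝ} (hW : CB A W) : TF (fun t x => W (t, x)) := by
  have hin : ∀ x : Eu d, CB A (fun t : ℝ => W (t, x)) := by
    intro x
    have := (hW.comp_add ((0 : ℝ), x)).comp_lin' (ContinuousLinearMap.inl ℝ ℝ (Eu d))
      (ContinuousLinearMap.norm_inl_le_one _ _ _)
    simpa using this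
  have hin2 : ∀ t : ℝ, CB A (fun x : Eu d => W (t, x)) := by
    intro t
    have := (hW.comp_add (t, (0 : Eu d))).comp_lin' (ContinuousLinearMap.inr ℝ ℝ (Eu d))
      (ContinuousLinearMap.norm_inr_le_one _ _ _)
    simpa using this
  obtain ⟨B, hB⟩ := hW.bd
  refine ⟨hW.continuous, fun x => (hin x).cdk 2 (by norm_num), ⟨A, fun t _ => hin2 t⟩,
    max A B, fun t _ x => ⟨(hB _).trans (le_max_right _ _), ?_, ?_⟩⟩
  · have := (hin x).der 1 le_rfl (by norm_num) t
    rw [norm_iteratedFDeriv_eq_norm_iteratedDeriv, iteratedDeriv_one] at this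
    exact this.trans (le_max_left _ _)
  · have := (hin x).der 2 (by norm_num) (by norm_num) t
    rw [norm_iteratedFDeriv_eq_norm_iteratedDeriv, iteratedDeriv_succ, iteratedDeriv_one] at this
    exact this.trans (le_max_left _ _)

/-- Spatial penalty. -/
theorem exists_penalty (x0 : Eu d) {M ε : ℝ} (hM : 0 ≤ M) (hε : 0 < ε) :
    ∃ (pen : Eu d → ℝ) (R : ℝ), CB ε pen ∧ pen x0 = 0 ∧ (∀ x, 0 ≤ pen x) ∧
      ∀ x, R ≤ ‖x - x0‖ → pen x = M := by
  let β : ContDiffBump (0 : Eu d) := ⟨1, 2, one_pos, one_lt_two⟩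
  obtain ⟨A, hA⟩ := CB.of_compact (f := (β : Eu d → ℝ)) (by exact_mod_cast β.contDiff (n := 3)) β.hasCompactSupport
  have hA0 := hA.nonneg
  set r : ℝ := min 1 (ε / (M * A + 1)) with hr
  have hrpos : 0 < r := by positivity
  have hr1 : r ≤ 1 := min_le_left _ _
  have hr2 : M * (A * r) ≤ ε := by
    have : r ≤ ε / (M * A + 1) := min_le_right _ _
    rw [le_div_iff₀ (by positivity)] at this
    nlinarith
  let g : Eu d →L[ℝ] Eu d := r • ContinuousLinearMap.id ℝ (Eu d)
  have hg : ‖g‖ ≤ r := by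
    refine (norm_smul_le _ _).trans ?_
    rw [Real.norm_of_nonneg hrpos.le]
    exact mul_le_of_le_one_right hrpos.le (ContinuousLinearMap.norm_id_le)
  have h1 := ((((hA.comp_lin g (hg.trans hr1)).comp_add (-x0)).smul (-M))).add_const M
  refine ⟨fun x => -M * β (g (x + -x0)) + M, 2 / r, h1.mono ?_, ?_, fun x => ?_, fun x hx => ?_⟩
  · rw [abs_neg, abs_of_nonneg hM]
    exact le_trans (by gcongr) hr2
  · have : β (g (x0 + -x0)) = 1 := by
      apply β.one_of_mem_closedBall
      simp [β]
    simp only [this]; ring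
  · have : β (g (x + -x0)) ≤ 1 := β.le_one
    nlinarith
  · have : β (g (x + -x0)) = 0 := by
      apply β.zero_of_le_dist
      show 2 ≤ _
      simp only [g, dist_zero_right, _root_.smul_apply, ContinuousLinearMap.id_apply, norm_smul,
        Real.norm_of_nonneg hrpos.le, ← sub_eq_add_neg]
      rw [div_le_iff₀ hrpos] at hx
      linarith
    simp only [this]; ring

end TFs

/-! ## Comparison with smooth supersolutions -/

section Sub
variable {d : ℕ}

theorem lemma_sub {K : ℝ} {Θ : Set (Trip d)} (hne : Θ.Nonempty) (hG : ∀ θ ∈ Θ, Good K θ)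
    {u : ℝ → Eu d → ℝ}
    (husc : UpperSemicontinuousOn (fun pt : ℝ × Eu d => u pt.1 pt.2) (Set.Ici 0 ×ˢ Set.univ))
    {C : ℝ} (hC : ∀ t, 0 ≤ t → ∀ x, |u t x| ≤ C)
    (hsub : IsViscositySubsolution Θ u)
    {Φ : ℝ → Eu d → ℝ} (hΦ : TF Φ) {t0 T : ℝ} (ht0 : 0 ≤ t0)
    (hineq : ∀ t, t0 < t → t < T → ∀ x, ∀ θ ∈ Θ, Lop θ (Φ t) x ≤ deriv (fun s => Φ s x) t)
    (hini : ∀ x, u t0 x ≤ Φ t0 x) :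
    ∀ t, t0 ≤ t → t < T → ∀ x, u t x ≤ Φ t x := by
  intro ts hts0 htsT xs
  by_contra hcon
  push Not at hcon
  have hts : t0 < ts := lt_of_le_of_ne hts0 (by rintro rfl; exact absurd (hini xs) (not_le.mpr hcon))
  set η := u ts xs - Φ ts xs with hη
  have hηpos : 0 < η := sub_pos.mpr hcon
  obtain ⟨B, hB⟩ := hΦ.bd
  obtain ⟨A, hA⟩ := hΦ.xcb
  have hC0 : 0 ≤ C := (abs_nonneg _).trans (hC 0 le_rfl 0)
  have hB0 : 0 ≤ B := (abs_nonneg _).trans (hB 0 le_rfl 0).1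
  set M : ℝ := C + B + 1 with hM
  have hM0 : 0 < M := by positivity
  have hdiff : ∀ t, 0 ≤ t → ∀ x, u t x - Φ t x < M := fun t ht x => by
    have h1 := (abs_le.mp (hC t ht x)).2
    have h2 := (abs_le.mp (hB t ht x).1).1
    linarith
  obtain ⟨θ0, hθ0⟩ := hne
  have hK0 : 0 ≤ K := (hG θ0 hθ0).nonneg
  -- the penalties
  set γ := η / 2 with hγ
  have hγpos : 0 < γ := by positivity
  set ε := γ * Real.exp (-T) / (3 * K + 1) with hε
  have hεpos : 0 < ε := by positivity
  have hεle : 3 * K * ε < γ * Real.exp (-T) := by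
    have : ε * (3 * K + 1) = γ * Real.exp (-T) := div_mul_cancel₀ _ (by positivity)
    nlinarith
  obtain ⟨pen, R, hpen, hpen0, hpennn, hpenR⟩ := exists_penalty xs hM0.le hεpos
  set ST : ℝ → ℝ := fun t => Real.smoothTransition ((t - ts) / (T - ts)) with hST
  have hSTtb : TB ST := TB.step htsT
  have hSTnn : ∀ t, 0 ≤ ST t := fun t => Real.smoothTransition.nonneg _
  have hST0 : ST ts = 0 := by simp [hST]
  have hST1 : ∀ t, T ≤ t → ST t = 1 := fun t ht => Real.smoothTransition.one_of_one_le
    ((one_le_div (sub_pos.mpr htsT)).mpr (by linarith))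
  set g : ℝ → ℝ := fun t => γ * (1 - Real.exp (-(t - 0))) + M * ST t with hg
  have hgtb : TB g := ((TB.expo 0).smul γ).add (hSTtb.smul M)
  have hgnn : ∀ t, 0 ≤ t → 0 ≤ g t := fun t ht => by
    have : Real.exp (-(t - 0)) ≤ 1 := Real.exp_le_one_iff.mpr (by linarith)
    have h2 := mul_nonneg hM0.le (hSTnn t)
    have h3 := mul_nonneg hγpos.le (sub_nonneg.mpr this)
    exact add_nonneg h3 h2
  have hgT : ∀ t, 0 ≤ t → T ≤ t → M ≤ g t := fun t ht htT => by
    have : Real.exp (-(t - 0)) ≤ 1 := Real.exp_le_one_iff.mpr (by linarith)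
    have h3 := mul_nonneg hγpos.le (sub_nonneg.mpr this)
    simp only [hg, hST1 t htT]; linarith
  -- the maximum
  set W : ℝ × Eu d → ℝ := fun p => u p.1 p.2 + -(Φ p.1 p.2 + pen p.2 + g p.1) with hW
  set D : Set (ℝ × Eu d) := Set.Icc t0 T ×ˢ Metric.closedBall xs (max R 0) with hD
  have hDc : IsCompact D := isCompact_Icc.prod (isCompact_closedBall _ _)
  have hDsub : D ⊆ Set.Ici 0 ×ˢ Set.univ := fun p hp => ⟨ht0.trans hp.1.1, mem_univ _⟩
  have hWusc : UpperSemicontinuousOn W D := by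
    refine UpperSemicontinuousOn.add (husc.mono hDsub) ?_
    have : Continuous fun p : ℝ × Eu d => -(Φ p.1 p.2 + pen p.2 + g p.1) := by
      have h1 := hΦ.cont
      have h2 := hpen.continuous
      have h3 := hgtb.cd.continuous
      fun_prop
    exact this.continuousOn.upperSemicontinuousOn
  have hmem : (ts, xs) ∈ D := ⟨⟨hts0, htsT.le⟩, Metric.mem_closedBall_self (le_max_right _ _)⟩
  obtain ⟨⟨t1, x1⟩, hp1, hmax⟩ := hWusc.exists_isMaxOn ⟨_, hmem⟩ hDc
  set m := W (t1, x1) with hm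
  have hWs : γ ≤ W (ts, xs) := by
    simp only [hW, hpen0, hg, hST0]
    have := mul_pos hγpos (Real.exp_pos (-(ts - 0)))
    linarith
  have hmpos : 0 < m := lt_of_lt_of_le hγpos (hWs.trans (hmax hmem))
  have ht1 : 0 ≤ t1 := ht0.trans hp1.1.1
  have hWle : ∀ t, t0 ≤ t → t ≤ T → ∀ x, W (t, x) ≤ m := by
    intro t h1 h2 x
    by_cases hx : R ≤ ‖x - xs‖
    · have e1 := hpenR x hx
      have e2 := hdiff t (ht0.trans h1) x
      have e3 := hgnn t (ht0.trans h1)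
      simp only [hW, e1]; linarith
    · push Not at hx
      refine hmax (a := (t, x)) ⟨⟨h1, h2⟩, ?_⟩
      rw [Metric.mem_closedBall, dist_eq_norm]
      exact hx.le.trans (le_max_left _ _)
  have ht1T : t1 < T := by
    refine lt_of_le_of_ne hp1.1.2 ?_
    intro h
    have e1 := hgT t1 ht1 h.ge
    have e2 := hdiff t1 ht1 x1
    have e3 := hpennn x1
    have : m = u t1 x1 + -(Φ t1 x1 + pen x1 + g t1) := rfl
    linarith
  have ht10 : t0 < t1 := by
    refine lt_of_le_of_ne hp1.1.1 ?_
    intro h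
    have e1 := hgnn t1 ht1
    have e2 := hini x1
    have e3 := hpennn x1
    have : m = u t1 x1 + -(Φ t1 x1 + pen x1 + g t1) := rfl
    rw [h] at e2
    linarith
  -- the time cutoff
  let β : ContDiffBump (t1 : ℝ) := ⟨(t1 - t0) / 2, t1 - t0, by linarith, by linarith⟩
  have hβtb : TB (β : ℝ → ℝ) := TB.of_compact (by exact_mod_cast β.contDiff (n := 2))
    β.hasCompactSupport.deriv (B := 1) (fun t => by
      rw [abs_of_nonneg β.nonneg]; exact β.le_one)
  have hβ1 : β t1 = 1 := β.one_of_mem_closedBall (Metric.mem_closedBall_self β.rIn_pos.le)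
  have hβd : deriv (β : ℝ → ℝ) t1 = 0 := by
    have : (β : ℝ → ℝ) =ᶠ[𝓝 t1] fun _ => 1 := β.eventuallyEq_one
    rw [this.deriv_eq]; simp
  have hβ0 : ∀ t, t ≤ t0 → β t = 0 := fun t ht => β.zero_of_le_dist (by
    show t1 - t0 ≤ _
    rw [Real.dist_eq, abs_of_nonpos (by linarith)]; linarith)
  set τ : ℝ → ℝ := fun t => (g t + (-M) * β t) + (M + m) with hτ
  have hτtb : TB τ := (hgtb.add (hβtb.smul (-M))).add (TB.const _)
  have hTF1 : TF (fun t x => Φ t x + pen x) := hΦ.add (TF.space hpen)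
  have hTF : TF (fun t x => (Φ t x + pen x) + τ t) := hTF1.add (TF.time hτtb)
  have key := hsub _ hTF.isC23b ?_ t1 (lt_of_le_of_lt ht0 ht10) x1 ?_
  · rw [hTF1.deriv_add (TF.time hτtb), hΦ.deriv_add (TF.space hpen)] at key
    have hτd : γ * Real.exp (-T) ≤ deriv τ t1 := by
      have e1 : deriv τ t1 = deriv g t1 := by
        have h1 : deriv τ t1 = deriv (fun t => g t + (-M) * β t) t1 := deriv_add_const _
        rw [h1, deriv_fun_add (hgtb.diff t1) ((hβtb.smul (-M)).diff t1), deriv_const_mul_field, hβd]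
        ring
      have e2 : deriv g t1 = γ * Real.exp (-(t1 - 0)) + M * deriv ST t1 := by
        rw [hg, deriv_fun_add (((TB.expo 0).smul γ).diff t1) ((hSTtb.smul M).diff t1),
          deriv_const_mul_field, deriv_const_mul_field, (hasDerivAt_expo 0 t1).deriv]
      have e3 : 0 ≤ deriv ST t1 := step_deriv_nonneg htsT t1
      have e4 : Real.exp (-T) ≤ Real.exp (-(t1 - 0)) := Real.exp_le_exp.mpr (by linarith)
      rw [e1, e2]
      have := mul_le_mul_of_nonneg_left e4 hγpos.le
      have := mul_nonneg hM0.le e3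
      linarith
    have hcb : CB (A + ε) (fun x => Φ t1 x + pen x) := (hA t1 ht1).add hpen
    have hGle := Gop_le ⟨θ0, hθ0⟩ (hcb.add_const (τ t1)) x1
      (r := deriv (fun s => Φ s x1) t1 + 3 * K * ε) (fun θ hθ => by
        rw [Lop_add_const (hG θ hθ) hcb, Lop_add (hG θ hθ) (hA t1 ht1) hpen]
        have h1 := hineq t1 ht10 ht1T x1 θ hθ
        have h2 := (abs_le.mp (Lop_abs_le (hG θ hθ) hpen x1)).2
        linarith)
    have e5 : deriv (fun _ : ℝ => pen x1) t1 = 0 := by simp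
    rw [e5] at key
    have e6 : deriv (fun s => τ s) t1 = deriv τ t1 := rfl
    rw [e6] at key
    linarith
  · intro t ht x
    have ht' : 0 ≤ t := le_of_lt ht
    have d1 := hdiff t ht' x
    have d2 := hgnn t ht'
    have d3 := hpennn x
    have d4 : β t ≤ 1 := β.le_one
    have d4' : M * β t ≤ M := mul_le_of_le_one_right hM0.le d4
    show u t x ≤ (Φ t x + pen x) + ((g t + (-M) * β t) + (M + m))
    rcases lt_or_ge t t0 with h | h
    · rw [hβ0 t h.le]; linarith
    · rcases le_or_gt t T with h' | h'
      · have h3 : u t x + -(Φ t x + pen x + g t) ≤ m := hWle t h h' x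
        linarith
      · have := hgT t ht' h'.le
        linarith
  · show (Φ t1 x1 + pen x1) + ((g t1 + (-M) * β t1) + (M + m)) = u t1 x1
    have : m = u t1 x1 + -(Φ t1 x1 + pen x1 + g t1) := rfl
    rw [hβ1, this]; ring

/-- The negative of a supersolution is a subsolution of each linear equation. -/
theorem neg_super {K : ℝ} {Θ : Set (Trip d)} (hG : ∀ θ ∈ Θ, Good K θ) {v : ℝ → Eu d → ℝ}
    (hsup : IsViscositySupersolution Θ v) {θ : Trip d} (hθ : θ ∈ Θ) :
    IsViscositySubsolution {θ} (fun t x => - v t x) := by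
  intro φ hφ hle t ht x heq
  have h1 : IsC23b (fun t x => - φ t x) := by
    obtain ⟨a1, a2, a3, C, a4⟩ := hφ
    refine ⟨a1.neg, fun x => (a2 x).neg, fun t ht => (a3 t ht).neg, C, fun t ht x => ?_⟩
    obtain ⟨b1, b2, b3, b4, b5, b6⟩ := a4 t ht x
    have e1 : deriv (fun s => - φ s x) = fun s => - deriv (fun s => φ s x) s := by
      funext s; exact deriv.fun_neg
    refine ⟨by rwa [abs_neg], by rw [e1, abs_neg]; exact b2,
      by rw [e1, deriv.fun_neg, abs_neg]; exact b3, ?_, ?_, ?_⟩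
    · change ‖fderiv ℝ (- φ t) x‖ ≤ C
      rw [fderiv_neg, norm_neg]; exact b4
    · change ‖iteratedFDeriv ℝ 2 (- φ t) x‖ ≤ C
      rw [iteratedFDeriv_neg, Pi.neg_apply, norm_neg]; exact b5
    · change ‖iteratedFDeriv ℝ 3 (- φ t) x‖ ≤ C
      rw [iteratedFDeriv_neg, Pi.neg_apply, norm_neg]; exact b6
  have hcb : ∃ A, CB A (φ t) := by
    obtain ⟨a1, a2, a3, C, a4⟩ := hφ
    refine ⟨C, a3 t ht, ⟨C, fun x => (a4 t ht x).1⟩, fun k k1 k3 x => ?_⟩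
    obtain ⟨b1, b2, b3, b4, b5, b6⟩ := a4 t ht x
    interval_cases k
    · rw [norm_iteratedFDeriv_one]; exact b4
    · exact b5
    · exact b6
  obtain ⟨A, hA⟩ := hcb
  have key := hsup _ h1 (fun t ht x => by have := hle t ht x; linarith) t ht x (by linarith)
  have k1 := le_Gop hG hA.neg x hθ
  rw [Lop_neg hA] at k1
  have k2 : deriv (fun s => - φ s x) t = - deriv (fun s => φ s x) t := deriv.fun_neg
  rw [k2] at key
  have k3 : Lop θ (φ t) x ≤ Gop {θ} (gradient (φ t) x) (hessMatrix (φ t) x) (fun z => φ t (x + z)) :=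
    le_Gop (K := K) (fun θ' h => by rw [mem_singleton_iff.mp h]; exact hG θ hθ) hA x rfl
  linarith

end Sub

/-! ## Initial layer and one-step estimates -/

/-- Bundled bounded upper semicontinuous subsolution. -/
structure SS {d : ℕ} (K : ℝ) (Θ : Set (Trip d)) (C : ℝ) (u : ℝ → Eu d → ℝ) : Prop where
  ne : Θ.Nonempty
  good : ∀ θ ∈ Θ, Good K θ
  usc : UpperSemicontinuousOn (fun pt : ℝ × Eu d => u pt.1 pt.2) (Set.Ici 0 ×ˢ Set.univ)
  bd : ∀ t, 0 ≤ t → ∀ x, |u t x| ≤ C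
  sub : IsViscositySubsolution Θ u

section Layer
variable {d : ℕ} {K C : ℝ} {Θ : Set (Trip d)} {u z : ℝ → Eu d → ℝ} {θ : Trip d}

theorem SS.K0 (h : SS K Θ C u) : 0 ≤ K := by
  obtain ⟨θ, hθ⟩ := h.ne
  exact (h.good θ hθ).nonneg

theorem SS.C0 (h : SS K Θ C u) : 0 ≤ C := (abs_nonneg _).trans (h.bd 0 le_rfl 0)

theorem one_sub_exp_le (t : ℝ) : 1 - Real.exp (-t) ≤ t := by
  have := Real.add_one_le_exp (-t); linarith

theorem one_sub_exp_ge {t : ℝ} (ht : 0 ≤ t) : t - t ^ 2 ≤ 1 - Real.exp (-t) := by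
  have h1 : Real.exp (-t) * (1 + t) ≤ 1 := by
    have h2 := Real.add_one_le_exp t
    have h3 : Real.exp (-t) * Real.exp t = 1 := by rw [← Real.exp_add]; simp
    have h4 := Real.exp_pos (-t)
    nlinarith
  have h4 := Real.exp_pos (-t)
  have h5 : (1 - t + t ^ 2) * (1 + t) ≥ 1 := by nlinarith [pow_nonneg ht 3]
  have h6 : Real.exp (-t) * (1 + t) ≤ (1 - t + t ^ 2) * (1 + t) := h1.trans h5
  have := le_of_mul_le_mul_right h6 (by linarith)
  linarith

theorem initial_layer (h : SS K Θ C u) {L : ℝ≥0} (hL : LipschitzWith L (u 0)) {ε : ℝ}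
    (hε : 0 < ε) : ∃ τ : ℝ, 0 < τ ∧ ∀ t, 0 ≤ t → t ≤ τ → ∀ x, u t x ≤ u 0 x + ε := by
  have hK := h.K0
  set r : ℝ := ε / (4 * ((L : ℝ) + 1)) with hr
  have hrpos : 0 < r := by positivity
  have hLr : (L : ℝ) * r ≤ ε / 4 := by
    have : r * (4 * ((L : ℝ) + 1)) = ε := div_mul_cancel₀ _ (by positivity)
    nlinarith
  obtain ⟨π, hπ, hsupp, A₀, hA0, hmol⟩ := exists_mollifier (Eu d) hrpos
  have hcb := hmol (u 0) C hL.continuous (h.bd 0 le_rfl)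
  have hnear := Avg_near π hsupp hL.continuous (h.bd 0 le_rfl) (NNReal.coe_nonneg L)
    (fun x y => by simpa [Real.dist_eq, dist_eq_norm] using hL.dist_le_mul x y)
  set A := C * A₀ with hA
  have hAnn := hcb.nonneg
  set C' := Real.exp 1 * (3 * K * A) with hC'
  have hC'0 : 0 ≤ C' := by positivity
  have hcb2 := hcb.add_const (L * r)
  have hTF2 : TF (fun t (_ : Eu d) => C' * (1 - Real.exp (-(t - 0)))) :=
    TF.time ((TB.expo 0).smul C')
  have hTF := (TF.space hcb2).add hTF2
  have key := lemma_sub h.ne h.good h.usc h.bd h.sub hTF (t0 := 0) (T := 1) le_rfl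
    (by
      intro t h0 h1 x θ hθ
      rw [(TF.space hcb2).deriv_add hTF2, Lop_add_const (h.good θ hθ) hcb2]
      have e1 : deriv (fun s => C' * (1 - Real.exp (-(s - 0)))) t = C' * Real.exp (-(t - 0)) := by
        rw [deriv_const_mul_field, (hasDerivAt_expo 0 t).deriv]
      rw [e1, deriv_const]
      have e2 := (abs_le.mp (Lop_abs_le (h.good θ hθ) hcb2 x)).2
      have e3 : Real.exp (-1) ≤ Real.exp (-(t - 0)) := Real.exp_le_exp.mpr (by linarith)
      have e4 : C' * Real.exp (-1) = 3 * K * A := by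
        rw [hC', mul_right_comm, ← Real.exp_add]; simp
      have e5 := mul_le_mul_of_nonneg_left e3 hC'0
      linarith)
    (by
      intro x
      have := (abs_le.mp (hnear x)).1
      simp only [sub_self, neg_zero, Real.exp_zero, mul_zero, add_zero]
      linarith)
  refine ⟨min (1 / 2) (ε / (2 * (C' + 1))), by positivity, fun t h0 h1 x => ?_⟩
  have ht1 : t ≤ 1 / 2 := h1.trans (min_le_left _ _)
  have ht2 : t * (2 * (C' + 1)) ≤ ε := by
    have := h1.trans (min_le_right _ _)
    rwa [le_div_iff₀ (by positivity)] at this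
  have k1 := key t h0 (by linarith) x
  have k2 := (abs_le.mp (hnear x)).2
  have k3 := mul_le_mul_of_nonneg_left (one_sub_exp_le (t - 0)) hC'0
  nlinarith

theorem Jop_eq (ν : Measure (Eu d)) [IsFiniteMeasure ν] {f : Eu d → ℝ} {A : ℝ} (hf : CB A f)
    (x : Eu d) : Jop ν f x = Avg ν f x - ν.real univ * f x := by
  obtain ⟨B, hB⟩ := hf.bd
  unfold Jop Avg
  rw [integral_sub (integrable_shift ν hf.continuous hB x) (integrable_const _), integral_const]
  rfl

theorem CB.jop (ν : Measure (Eu d)) [IsFiniteMeasure ν] {f : Eu d → ℝ} {A : ℝ} (hf : CB A f) :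
    CB (2 * ν.real univ * A) (Jop ν f) := by
  have h := (hf.avg ν).add (hf.smul (-(ν.real univ)))
  have e : Jop ν f = fun x => Avg ν f x + -(ν.real univ) * f x := by
    funext x; rw [Jop_eq ν hf]; ring
  rw [e]
  refine h.mono (le_of_eq ?_)
  rw [abs_neg, abs_of_nonneg measureReal_nonneg]; ring

/-- `ν` approximates `Lop θ` with error `ε`. -/
def ApproxBy (θ : Trip d) (ν : Measure (Eu d)) (ε : ℝ) : Prop :=
  ∀ A f, CB A f → ∀ x, |Lop θ f x - Jop ν f x| ≤ ε * A

theorem lin_step (hz : SS K {θ} C z) {A ε ε1 : ℝ} (hA : 0 ≤ A) (hε : 0 < ε)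
    {ν : Measure (Eu d)} [IsFiniteMeasure ν] (hν : ApproxBy θ ν ε1) (hε1 : ε1 * A ≤ ε / 4) :
    ∃ h0 : ℝ, 0 < h0 ∧ ∀ h, 0 ≤ h → h ≤ h0 → ∀ w, CB A w → ∀ t0, 0 ≤ t0 →
      (∀ x, z t0 x ≤ w x) → ∀ x, z (t0 + h) x ≤ w x + h * Jop ν w x + h * ε := by
  have hK := hz.K0
  have hθ : Good K θ := hz.good θ rfl
  set l := ν.real univ with hl
  have hl0 : 0 ≤ l := measureReal_nonneg
  set Q : ℝ := 6 * K * l * A + 3 * K * A + ε with hQ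
  have hQ0 : 0 < Q := by positivity
  set h1 : ℝ := ε / (4 * Q) with hh1
  have hh1pos : 0 < h1 := by positivity
  have hh1Q : h1 * Q = ε / 4 := by rw [hh1]; field_simp
  refine ⟨h1 / 2, by positivity, fun h hh hhle w hw t0 ht0 hini x => ?_⟩
  have hcb := (hw.jop ν).add_const (ε / 2)
  set k : Eu d → ℝ := fun x => Jop ν w x + ε / 2 with hk
  have hkbd : ∀ x, |k x| ≤ 3 * K * A + ε := fun x => by
    have e1 := abs_le.mp (hν A w hw x)
    have e2 := abs_le.mp (Lop_abs_le hθ hw x)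
    have : k x = Jop ν w x + ε / 2 := rfl
    rw [abs_le]; constructor <;> linarith [e1.1, e1.2, e2.1, e2.2]
  have hTF2 : TF (fun t x => (1 - Real.exp (-(t - t0))) * k x) := TF.mul (TB.expo t0) hcb
  have hTF := (TF.space hw).add hTF2
  have key := lemma_sub hz.ne hz.good hz.usc hz.bd hz.sub hTF (t0 := t0) (T := t0 + h1) ht0
    (by
      intro t ht ht' x θ' hθ'
      rw [mem_singleton_iff.mp hθ', (TF.space hw).deriv_add hTF2, deriv_const,
        deriv_mul_const_field, (hasDerivAt_expo t0 t).deriv,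
        Lop_add hθ hw (hcb.smul _), Lop_smul hcb]
      set s := t - t0 with hs
      have hs0 : 0 ≤ s := by linarith
      have hsQ : s * Q ≤ ε / 4 := by
        rw [← hh1Q]; exact mul_le_mul_of_nonneg_right (by linarith) hQ0.le
      have a1 := one_sub_exp_le s
      have a2 : 0 ≤ 1 - Real.exp (-s) := sub_nonneg.mpr (Real.exp_le_one_iff.mpr (by linarith))
      have a3 := Lop_abs_le hθ hcb x
      have a4 := (abs_le.mp (hν A w hw x)).2
      have a5 : (1 - Real.exp (-s)) * Lop θ k x ≤ s * (6 * K * l * A) := by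
        calc _ ≤ (1 - Real.exp (-s)) * |Lop θ k x| :=
              mul_le_mul_of_nonneg_left (le_abs_self _) a2
          _ ≤ s * (3 * K * (2 * l * A)) := mul_le_mul a1 a3 (abs_nonneg _) hs0
          _ = _ := by ring
      have a6 : (1 - Real.exp (-s)) * k x ≤ s * (3 * K * A + ε) := by
        calc _ ≤ (1 - Real.exp (-s)) * |k x| := mul_le_mul_of_nonneg_left (le_abs_self _) a2
          _ ≤ _ := mul_le_mul a1 (hkbd x) (abs_nonneg _) hs0
      have a7 : s * Q = s * (6 * K * l * A) + s * (3 * K * A + ε) := by rw [hQ]; ring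
      have a8 : k x = Jop ν w x + ε / 2 := rfl
      linarith)
    (by
      intro x
      simpa using hini x)
  have k1 := key (t0 + h) (by linarith) (by linarith) x
  have e0 : t0 + h - t0 = h := by ring
  rw [e0] at k1
  have b1 := one_sub_exp_le h
  have b2 := one_sub_exp_ge hh
  have b3 : (1 - Real.exp (-h)) * k x ≤ h * k x + h ^ 2 * (3 * K * A + ε) := by
    have c1 : (1 - Real.exp (-h) - h) * k x ≤ h ^ 2 * (3 * K * A + ε) := by
      calc _ ≤ |(1 - Real.exp (-h) - h) * k x| := le_abs_self _
        _ = |1 - Real.exp (-h) - h| * |k x| := abs_mul _ _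
        _ ≤ _ := mul_le_mul (abs_le.mpr ⟨by linarith, by nlinarith⟩) (hkbd x) (abs_nonneg _)
          (by positivity)
    linarith
  have b4 : h * (3 * K * A + ε) ≤ ε / 4 := by
    have : h * (3 * K * A + ε) ≤ h1 * Q := by
      apply mul_le_mul (by linarith) _ (by positivity) hh1pos.le
      rw [hQ]
      have : 0 ≤ 6 * K * l * A := by positivity
      linarith
    linarith
  have b5 := mul_le_mul_of_nonneg_left b4 hh
  have a8 : h * k x = h * Jop ν w x + h * (ε / 2) := by rw [hk]; ring
  nlinarith

end Layer

/-! ## Iterated steps -/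

section Semi
variable {d : ℕ} {K C : ℝ} {z : ℝ → Eu d → ℝ} {θ : Trip d}

/-- One step kernel. -/
def stepM (ν : Measure (Eu d)) (h : ℝ) : Measure (Eu d) :=
  (1 - h * ν.real univ).toNNReal • Measure.dirac 0 + h.toNNReal • ν

instance stepM_fin (ν : Measure (Eu d)) [IsFiniteMeasure ν] (h : ℝ) :
    IsFiniteMeasure (stepM ν h) := by unfold stepM; infer_instance

theorem stepM_prob (ν : Measure (Eu d)) [IsFiniteMeasure ν] {h : ℝ} (h0 : 0 ≤ h)
    (h1 : h * ν.real univ ≤ 1) : IsProbabilityMeasure (stepM ν h) := by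
  constructor
  have : (stepM ν h).real univ = 1 := by
    unfold stepM
    rw [measureReal_add_apply, measureReal_nnreal_smul_apply, measureReal_nnreal_smul_apply,
      Real.coe_toNNReal _ (by linarith), Real.coe_toNNReal _ h0]
    simp
  rw [measureReal_def] at this
  rwa [ENNReal.toReal_eq_one_iff] at this

theorem Avg_stepM (ν : Measure (Eu d)) [IsFiniteMeasure ν] {h : ℝ} (h0 : 0 ≤ h)
    (h1 : h * ν.real univ ≤ 1) {f : Eu d → ℝ} {A : ℝ} (hf : CB A f) (x : Eu d) :
    Avg (stepM ν h) f x = f x + h * Jop ν f x := by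
  obtain ⟨B, hB⟩ := hf.bd
  rw [Jop_eq ν hf]
  unfold Avg stepM
  rw [integral_add_measure (integrable_shift _ hf.continuous hB x)
    (integrable_shift _ hf.continuous hB x), integral_smul_nnreal_measure,
    integral_smul_nnreal_measure, integral_dirac]
  simp only [NNReal.smul_def, smul_eq_mul, Real.coe_toNNReal _ h0,
    Real.coe_toNNReal _ (sub_nonneg.mpr h1), add_zero]
  ring

/-- Convolution powers. -/
def cpow (μ : Measure (Eu d)) : ℕ → Measure (Eu d)
  | 0 => Measure.dirac 0
  | n + 1 => cpow μ n ∗ μ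

theorem cpow_prob (μ : Measure (Eu d)) [IsProbabilityMeasure μ] (n : ℕ) :
    IsProbabilityMeasure (cpow μ n) := by
  induction n with
  | zero => unfold cpow; infer_instance
  | succ n ih => unfold cpow; infer_instance

theorem Avg_cpow_zero (μ : Measure (Eu d)) (f : Eu d → ℝ) (x : Eu d) :
    Avg (cpow μ 0) f x = f x := by
  simp [Avg, cpow]

theorem Avg_cpow_succ (μ : Measure (Eu d)) [IsProbabilityMeasure μ] (n : ℕ) {f : Eu d → ℝ} {A : ℝ}
    (hf : CB A f) (x : Eu d) : Avg (cpow μ (n + 1)) f x = Avg (cpow μ n) (Avg μ f) x := by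
  haveI := cpow_prob μ n
  obtain ⟨B, hB⟩ := hf.bd
  exact Avg_conv _ _ hf.continuous hB x

theorem n_step {ν : Measure (Eu d)} [IsFiniteMeasure ν] {A ε h : ℝ} (h0 : 0 ≤ h)
    (h1 : h * ν.real univ ≤ 1)
    (hstep : ∀ w, CB A w → ∀ t0, 0 ≤ t0 →
      (∀ x, z t0 x ≤ w x) → ∀ x, z (t0 + h) x ≤ w x + h * Jop ν w x + h * ε) (n : ℕ) :
    ∀ w, CB A w → ∀ t0, 0 ≤ t0 → (∀ x, z t0 x ≤ w x) →
      ∀ x, z (t0 + n * h) x ≤ Avg (cpow (stepM ν h) n) w x + n * h * ε := by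
  haveI := stepM_prob ν h0 h1
  induction n with
  | zero =>
    intro w hw t0 ht0 hle x
    rw [Avg_cpow_zero]; simpa using hle x
  | succ n ih =>
    intro w hw t0 ht0 hle x
    have hw1 := hw.avg1 (stepM ν h)
    have e1 : ∀ x, z (t0 + h) x ≤ Avg (stepM ν h) w x + h * ε := fun x => by
      rw [Avg_stepM ν h0 h1 hw]; exact hstep w hw t0 ht0 hle x
    have e2 := ih _ (hw1.add_const (h * ε)) (t0 + h) (by linarith) e1 x
    haveI := cpow_prob (stepM ν h) n
    obtain ⟨B, hB⟩ := hw1.bd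
    rw [Avg_add_const _ hw1.continuous hB, ← Avg_cpow_succ _ _ hw] at e2
    have e3 : t0 + h + n * h = t0 + ((n + 1 : ℕ) : ℝ) * h := by push_cast; ring
    rw [e3] at e2
    push_cast at e2 ⊢
    linarith

theorem Jop_bound (hθ : Good K θ) {ν : Measure (Eu d)} {ε1 : ℝ} (hν : ApproxBy θ ν ε1)
    {f : Eu d → ℝ} {A : ℝ} (hf : CB A f) (x : Eu d) : |Jop ν f x| ≤ (3 * K + ε1) * A := by
  have e1 := abs_le.mp (hν A f hf x)
  have e2 := abs_le.mp (Lop_abs_le hθ hf x)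
  rw [abs_le]; constructor <;> nlinarith [e1.1, e1.2, e2.1, e2.2]

theorem expand1 (hθ : Good K θ) {ν : Measure (Eu d)} [IsFiniteMeasure ν] {ε1 h : ℝ}
    (hν : ApproxBy θ ν ε1) (h0 : 0 ≤ h) (h1 : h * ν.real univ ≤ 1)
    {f : Eu d → ℝ} {A : ℝ} (hf : CB A f) (n : ℕ) (x : Eu d) :
    Avg (cpow (stepM ν h) n) f x ≤ f x + n * h * ((3 * K + ε1) * A) := by
  haveI := stepM_prob ν h0 h1
  induction n with
  | zero => rw [Avg_cpow_zero]; simp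
  | succ n ih =>
    haveI := cpow_prob (stepM ν h) n
    rw [Avg_cpow_succ _ _ hf]
    obtain ⟨B, hB⟩ := hf.bd
    obtain ⟨B', hB'⟩ := (hf.avg1 (stepM ν h)).bd
    obtain ⟨B2, hB2⟩ := (hf.add_const (h * ((3 * K + ε1) * A))).bd
    have e1 := Avg_mono (cpow (stepM ν h) n) (hf.avg1 (stepM ν h)).continuous hB'
      (hf.add_const (h * ((3 * K + ε1) * A))).continuous hB2 (fun y => by
        rw [Avg_stepM ν h0 h1 hf]
        have := mul_le_mul_of_nonneg_left (abs_le.mp (Jop_bound hθ hν hf y)).2 h0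
        linarith) x
    rw [Avg_add_const _ hf.continuous hB] at e1
    push_cast
    linarith

theorem expand2 (hθ : Good K θ) {ν ν' : Measure (Eu d)} [IsFiniteMeasure ν] [IsFiniteMeasure ν']
    {ε1 ε2 h : ℝ} (hε1 : 0 ≤ ε1)
    (hν : ApproxBy θ ν ε1) (hν' : ApproxBy θ ν' ε2) (h0 : 0 ≤ h) (h1 : h * ν.real univ ≤ 1)
    {g : Eu d → ℝ} {A : ℝ} (hg : CB A g) (N n : ℕ) (hn : n ≤ N) (x : Eu d) :
    Avg (cpow (stepM ν h) n) g x ≤ g x + n * h * (Lop θ g x + (ε1 + 2 * ε2) * A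
      + N * h * ((3 * K + ε1) * (2 * ν'.real univ * A))) := by
  haveI := stepM_prob ν h0 h1
  have hK := hθ.nonneg
  have hA := hg.nonneg
  have hl : 0 ≤ ν'.real univ := measureReal_nonneg
  induction n with
  | zero => rw [Avg_cpow_zero]; simp
  | succ n ih =>
    haveI := cpow_prob (stepM ν h) n
    have ih := ih (by omega)
    rw [Avg_cpow_succ _ _ hg]
    obtain ⟨B, hB⟩ := hg.bd
    obtain ⟨B', hB'⟩ := (hg.avg1 (stepM ν h)).bd
    have hF := hg.jop ν'
    have hF1 := hF.add_const ((ε1 + ε2) * A)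
    have hF2 := hF1.smul h
    have hsum := hg.add hF2
    obtain ⟨B1, hB1⟩ := hF.bd
    obtain ⟨B2, hB2⟩ := hF2.bd
    obtain ⟨B3, hB3⟩ := hsum.bd
    have e1 := Avg_mono (cpow (stepM ν h) n) (hg.avg1 (stepM ν h)).continuous hB'
      hsum.continuous hB3 (fun y => by
        rw [Avg_stepM ν h0 h1 hg]
        have a1 := (abs_le.mp (hν A g hg y)).1
        have a2 := (abs_le.mp (hν' A g hg y)).2
        have : Jop ν g y ≤ Jop ν' g y + (ε1 + ε2) * A := by linarith
        have := mul_le_mul_of_nonneg_left this h0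
        linarith) x
    rw [Avg_add _ hg.continuous hB hF2.continuous hB2, Avg_smul,
      Avg_add_const _ hF.continuous hB1] at e1
    have e2 := expand1 hθ hν h0 h1 hF n x
    have e3 := (abs_le.mp (hν' A g hg x)).1
    have e4 : (n : ℝ) * h * ((3 * K + ε1) * (2 * ν'.real univ * A))
        ≤ N * h * ((3 * K + ε1) * (2 * ν'.real univ * A)) := by
      have : (n : ℝ) ≤ N := by exact_mod_cast (by omega : n ≤ N)
      gcongr
    have e5 : Avg (cpow (stepM ν h) n) (Jop ν' g) x + (ε1 + ε2) * A
      ≤ Lop θ g x + (ε1 + 2 * ε2) * A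
      + N * h * ((3 * K + ε1) * (2 * ν'.real univ * A)) := by linarith
    have e6 := mul_le_mul_of_nonneg_left e5 h0
    push_cast
    linarith

theorem semigroup (hz : SS K {θ} C z) {A ε ε1 s : ℝ} (hA : 0 ≤ A) (hε : 0 < ε) (hε1 : 0 < ε1)
    (hs : 0 < s) : ∃ m : Measure (Eu d), IsProbabilityMeasure m ∧
      (∀ w, CB A w → ∀ t0, 0 ≤ t0 → (∀ x, z t0 x ≤ w x) →
        ∀ x, z (t0 + s) x ≤ Avg m w x + s * ε) ∧
      ∀ g A', CB A' g → ∀ (ν' : Measure (Eu d)) [IsFiniteMeasure ν'] (ε2 : ℝ),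
        ApproxBy θ ν' ε2 → ∀ x, Avg m g x ≤ g x + s * (Lop θ g x + (ε1 + 2 * ε2) * A'
          + s * ((3 * K + ε1) * (2 * ν'.real univ * A'))) := by
  have hθ : Good K θ := hz.good θ rfl
  have hK := hθ.nonneg
  set e := min ε1 (ε / (4 * (A + 1))) with he
  have hepos : 0 < e := by positivity
  have heA : e * A ≤ ε / 4 := by
    have : e ≤ ε / (4 * (A + 1)) := min_le_right _ _
    rw [le_div_iff₀ (by positivity)] at this
    nlinarith
  have hee : e ≤ ε1 := min_le_left _ _
  obtain ⟨ν, hνf, hν⟩ := exists_approx hθ hepos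
  obtain ⟨h0, hh0, hstep⟩ := lin_step hz hA hε hν heA
  set l := ν.real univ with hl
  have hl0 : 0 ≤ l := measureReal_nonneg
  obtain ⟨n, hn⟩ := exists_nat_ge (s / h0 + s * l + 1)
  have hn0 : 0 < s / h0 := by positivity
  have hsl : 0 ≤ s * l := by positivity
  have hnpos : (0 : ℝ) < n := by linarith
  set h := s / n with hh
  have hhpos : 0 < h := by positivity
  have hnh : n * h = s := by rw [hh]; field_simp
  have hh1 : h ≤ h0 := by
    rw [hh, div_le_iff₀ hnpos]
    have : s / h0 ≤ n := by linarith
    rw [div_le_iff₀ hh0] at this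
    linarith
  have hh2 : h * l ≤ 1 := by
    rw [hh, div_mul_eq_mul_div, div_le_one hnpos]; linarith
  haveI := stepM_prob ν hhpos.le hh2
  refine ⟨cpow (stepM ν h) n, cpow_prob _ n, ?_, ?_⟩
  · intro w hw t0 ht0 hle x
    have := n_step hhpos.le hh2 (hstep h hhpos.le hh1) n w hw t0 ht0 hle x
    rwa [hnh] at this
  · intro g A' hg ν' _ ε2 hν' x
    have := expand2 hθ hepos.le hν hν' hhpos.le hh2 hg n n le_rfl x
    rw [hnh] at this
    refine this.trans ?_
    have hA' := hg.nonneg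
    have hl : 0 ≤ ν'.real univ := measureReal_nonneg
    gcongr

end Semi

/-- Extension of a function on `[0,∞) × ℝ^d` to negative times. -/
def zext {d : ℕ} (C : ℝ) (z : ℝ → Eu d → ℝ) (p : ℝ × Eu d) : ℝ :=
  if 0 ≤ p.1 then z p.1 p.2 else -C

/-- Lipschitz sup-convolution. -/
def zt {d : ℕ} (C Λ : ℝ) (z : ℝ → Eu d → ℝ) (q : ℝ × Eu d) : ℝ :=
  ⨆ p : ℝ × Eu d, (zext C z p - Λ * ‖p - q‖)

section Reg
variable {d : ℕ} {K C Λ : ℝ} {z : ℝ → Eu d → ℝ} {θ : Trip d}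

theorem zext_bd (hC : 0 ≤ C) (hb : ∀ t, 0 ≤ t → ∀ x, |z t x| ≤ C) (p : ℝ × Eu d) :
    |zext C z p| ≤ C := by
  unfold zext
  split_ifs with h
  · exact hb _ h _
  · rw [abs_neg, abs_of_nonneg hC]

theorem le_zt (hC : 0 ≤ C) (hb : ∀ t, 0 ≤ t → ∀ x, |z t x| ≤ C) (hΛ : 0 ≤ Λ)
    (p q : ℝ × Eu d) : zext C z p - Λ * ‖p - q‖ ≤ zt C Λ z q := by
  refine le_ciSup (f := fun p : ℝ × Eu d => zext C z p - Λ * ‖p - q‖) ⟨C, ?_⟩ p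
  rintro _ ⟨p, rfl⟩
  have := (abs_le.mp (zext_bd hC hb p)).2
  have h2 : 0 ≤ Λ * ‖p - q‖ := by positivity
  simp only
  linarith

theorem zext_le_zt (hC : 0 ≤ C) (hb : ∀ t, 0 ≤ t → ∀ x, |z t x| ≤ C) (hΛ : 0 ≤ Λ)
    (q : ℝ × Eu d) : zext C z q ≤ zt C Λ z q := by
  have := le_zt hC hb hΛ q q
  simpa using this

theorem zt_le {q : ℝ × Eu d} {B : ℝ} (h : ∀ p, zext C z p - Λ * ‖p - q‖ ≤ B) :
    zt C Λ z q ≤ B := ciSup_le h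

theorem zt_bd (hC : 0 ≤ C) (hb : ∀ t, 0 ≤ t → ∀ x, |z t x| ≤ C) (hΛ : 0 ≤ Λ)
    (q : ℝ × Eu d) : |zt C Λ z q| ≤ C := by
  rw [abs_le]
  constructor
  · exact (abs_le.mp (zext_bd hC hb q)).1.trans (zext_le_zt hC hb hΛ q)
  · refine zt_le fun p => ?_
    have := (abs_le.mp (zext_bd hC hb p)).2
    have h2 : 0 ≤ Λ * ‖p - q‖ := by positivity
    linarith

theorem zt_lip (hC : 0 ≤ C) (hb : ∀ t, 0 ≤ t → ∀ x, |z t x| ≤ C) (hΛ : 0 ≤ Λ)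
    (q q' : ℝ × Eu d) : |zt C Λ z q - zt C Λ z q'| ≤ Λ * ‖q - q'‖ := by
  have key : ∀ q q' : ℝ × Eu d, zt C Λ z q ≤ zt C Λ z q' + Λ * ‖q - q'‖ := by
    intro q q'
    refine zt_le fun p => ?_
    have h1 := le_zt hC hb hΛ p q'
    have h2 : ‖p - q'‖ ≤ ‖p - q‖ + ‖q - q'‖ := by
      have := norm_add_le (p - q) (q - q')
      simpa using this
    have h3 := mul_le_mul_of_nonneg_left h2 hΛ
    linarith
  rw [abs_le]
  have h1 := key q q'
  have h2 := key q' q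
  rw [norm_sub_rev q' q] at h2
  constructor <;> linarith

theorem zt_cont (hC : 0 ≤ C) (hb : ∀ t, 0 ≤ t → ∀ x, |z t x| ≤ C) (hΛ : 0 ≤ Λ) :
    Continuous (zt C Λ z) := by
  have : LipschitzWith Λ.toNNReal (zt C Λ z) := by
    refine LipschitzWith.of_dist_le_mul fun q q' => ?_
    rw [Real.coe_toNNReal _ hΛ, Real.dist_eq, dist_eq_norm]
    exact zt_lip hC hb hΛ q q'
  exact this.continuous

theorem zt_far {a : ℝ} (hC : 0 ≤ C) (hb : ∀ t, 0 ≤ t → ∀ x, |z t x| ≤ C) (hΛ : 0 ≤ Λ)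
    (ha : 2 * C ≤ Λ * a) {p q : ℝ × Eu d} (h : a ≤ ‖p - q‖ ∨ p.1 < 0) :
    zext C z p - Λ * ‖p - q‖ ≤ -C := by
  rcases h with h | h
  · have h1 := (abs_le.mp (zext_bd hC hb p)).2
    have h2 := mul_le_mul_of_nonneg_left h hΛ
    linarith
  · have : zext C z p = -C := by unfold zext; rw [if_neg (not_le.mpr h)]
    have h2 : 0 ≤ Λ * ‖p - q‖ := by positivity
    linarith

theorem zt_trans {a A s ε : ℝ} (hC : 0 ≤ C) (hb : ∀ t, 0 ≤ t → ∀ x, |z t x| ≤ C)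
    (hΛ : 0 ≤ Λ) (ha : 2 * C ≤ Λ * a) (hs : 0 < s) (hε : 0 < ε)
    (m : Measure (Eu d)) [IsProbabilityMeasure m]
    (hm : ∀ w, CB A w → ∀ t0, 0 ≤ t0 → (∀ x, z t0 x ≤ w x) →
        ∀ x, z (t0 + s) x ≤ Avg m w x + s * ε)
    {w : Eu d → ℝ} (hw : CB A w) {t : ℝ} (ht : a ≤ t)
    (hle : ∀ x, zt C Λ z (t, x) ≤ w x) (x : Eu d) :
    zt C Λ z (t + s, x) ≤ Avg m w x + s * ε := by
  obtain ⟨B, hB⟩ := hw.bd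
  have hsε : 0 < s * ε := by positivity
  have hlow : -C ≤ Avg m w x := by
    have h1 := Avg_mono m (f := fun _ : Eu d => -C) (g := w) (C := C) continuous_const
      (fun _ => by rw [abs_neg, abs_of_nonneg hC]) hw.continuous hB
      (fun y => (abs_le.mp (zt_bd hC hb hΛ (t, y))).1.trans (hle y)) x
    simpa [Avg] using h1
  refine zt_le fun p => ?_
  obtain ⟨p1, p2⟩ := p
  by_cases h1 : 0 ≤ p1 - s
  · set c := Λ * ‖((p1, p2) : ℝ × Eu d) - (t + s, x)‖ with hc
    have hcb : CB A (fun y => w (y + (x - p2)) + c) := (hw.comp_add _).add_const c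
    have h2 := hm _ hcb (p1 - s) h1 (fun y => by
      have h3 := le_zt hC hb hΛ (p1 - s, y) (t, y + (x - p2))
      have e1 : zext C z (p1 - s, y) = z (p1 - s) y := by
        unfold zext; rw [if_pos h1]
      have e2 : ((p1 - s, y) : ℝ × Eu d) - (t, y + (x - p2)) = (p1, p2) - (t + s, x) := by
        ext1
        · simp only [Prod.fst_sub]; ring
        · simp only [Prod.snd_sub]; abel
      rw [e1, e2] at h3
      have h4 := hle (y + (x - p2))
      linarith) p2
    have hcont : Continuous fun y => w (y + (x - p2)) := (hw.comp_add _).continuous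
    rw [Avg_add_const m hcont (fun y => hB _), Avg_shift, sub_add_cancel,
      add_sub_cancel] at h2
    have e1 : zext C z (p1, p2) = z p1 p2 := by
      unfold zext; rw [if_pos]; simp only; linarith
    rw [e1]
    linarith
  · refine (zt_far (a := a) hC hb hΛ ha ?_).trans (by linarith)
    left
    refine le_trans ?_ (norm_fst_le _)
    simp only [Prod.fst_sub, Real.norm_eq_abs]
    rw [abs_sub_comm]
    refine le_trans ?_ (le_abs_self _)
    linarith [not_le.mp h1]

theorem zt_step (hz : SS K {θ} C z) (hΛ : 0 ≤ Λ) {a s ε : ℝ} (ha : 2 * C ≤ Λ * a)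
    (hs : 0 < s) (hε : 0 < ε) : ∃ m : Measure (Eu d), IsProbabilityMeasure m ∧
      (∀ t, a ≤ t → ∀ x, zt C Λ z (t + s, x) ≤ Avg m (fun y => zt C Λ z (t, y)) x + 2 * s * ε) ∧
      ∀ g A', CB A' g → ∀ (ν' : Measure (Eu d)) [IsFiniteMeasure ν'] (ε2 : ℝ),
        ApproxBy θ ν' ε2 → ∀ x, Avg m g x ≤ g x + s * (Lop θ g x + (ε + 2 * ε2) * A'
          + s * ((3 * K + ε) * (2 * ν'.real univ * A'))) := by
  have hC := hz.C0
  have hb := hz.bd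
  set r : ℝ := s * ε / (2 * (Λ + 1)) with hr
  have hrpos : 0 < r := by positivity
  have hrle : 2 * (Λ * r) ≤ s * ε := by
    have : r * (2 * (Λ + 1)) = s * ε := by rw [hr]; field_simp
    nlinarith
  obtain ⟨κ, hκ, hsupp, A₀, hA₀, hmol⟩ := exists_mollifier (Eu d) hrpos
  obtain ⟨m, hm, hm1, hm2⟩ := semigroup hz (A := C * A₀) (by positivity) hε hε hs
  refine ⟨m, hm, fun t ht x => ?_, hm2⟩
  set f : Eu d → ℝ := fun y => zt C Λ z (t, y) with hf
  have hfc : Continuous f := (zt_cont hC hb hΛ).comp (by fun_prop)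
  have hfb : ∀ y, |f y| ≤ C := fun y => zt_bd hC hb hΛ _
  have hfl : ∀ y y', |f y - f y'| ≤ Λ * ‖y - y'‖ := by
    intro y y'
    have := zt_lip hC hb hΛ (t, y) (t, y')
    simpa [Prod.norm_def] using this
  have hcb := (hmol f C hfc hfb)
  have hnear := Avg_near κ hsupp hfc hfb hΛ hfl
  have h1 := zt_trans hC hb hΛ ha hs hε m hm1 (hcb.add_const (Λ * r)) ht (fun y => by
    have := (abs_le.mp (hnear y)).1
    change f y ≤ _
    linarith) x
  rw [Avg_add_const m hcb.continuous (fun y => Avg_bound1 κ hfb y)] at h1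
  have h2 := Avg_mono m hcb.continuous (fun y => Avg_bound1 κ hfb y)
    (g := fun y => f y + Λ * r) (C' := C + Λ * r) (by fun_prop)
    (fun y => (abs_add_le _ _).trans (add_le_add (hfb y) (le_of_eq (abs_of_nonneg (by positivity)))))
    (fun y => by
      have := (abs_le.mp (hnear y)).2
      linarith) x
  rw [Avg_add_const m hfc hfb] at h2
  linarith

theorem Z_step {a δ s B t : ℝ} {f : ℝ × Eu d → ℝ} (hf : Continuous f) (hC : ∀ q, |f q| ≤ C)
    (m : Measure (Eu d)) [IsProbabilityMeasure m] (π : Measure (ℝ × Eu d))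
    [IsProbabilityMeasure π] (hπ : ∀ᵐ q ∂π, ‖q‖ ≤ δ)
    (h : ∀ t, a ≤ t → ∀ x, f (t + s, x) ≤ Avg m (fun y => f (t, y)) x + B)
    (ht : a + δ ≤ t) (x : Eu d) :
    Avg π f (t + s, x) ≤ Avg m (fun y => Avg π f (t, y)) x + B := by
  have hprod : Integrable (fun p : (ℝ × Eu d) × Eu d => f (t + p.1.1, x + p.1.2 + p.2))
      (π.prod m) := by
    refine (integrable_const C).mono' ?_ (Eventually.of_forall fun p => hC _)
    exact (hf.comp (by fun_prop)).aestronglyMeasurable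
  have h1 : Avg π f (t + s, x)
      ≤ ∫ q, ((∫ y, f (t + q.1, x + q.2 + y) ∂m) + B) ∂π := by
    unfold Avg
    refine integral_mono_ae (integrable_shift π hf hC _)
      (hprod.integral_prod_left.add (integrable_const B)) ?_
    filter_upwards [hπ] with q hq
    have hq1 : |q.1| ≤ δ := (norm_fst_le q).trans hq
    have := h (t + q.1) (by linarith [(abs_le.mp hq1).1]) (x + q.2)
    have e : ((t + s, x) : ℝ × Eu d) + q = (t + q.1 + s, x + q.2) := by
      ext1
      · simp only [Prod.fst_add]; ring
      · simp only [Prod.snd_add]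
    simp only [e]
    exact this
  rw [integral_add hprod.integral_prod_left (integrable_const B),
    integral_integral_swap hprod] at h1
  refine h1.trans (le_of_eq ?_)
  simp only [Avg, integral_const, probReal_univ, one_smul]
  congr 1
  refine integral_congr_ae (Eventually.of_forall fun y => ?_)
  refine integral_congr_ae (Eventually.of_forall fun q => ?_)
  simp only
  congr 1
  ext1
  · simp only [Prod.fst_add]
  · simp only [Prod.snd_add]; abel

theorem deriv_le_of_step {f : ℝ → ℝ} {t L c : ℝ} (hf : DifferentiableAt ℝ f t) (hc : 0 ≤ c)
    (h : ∀ ε, 0 < ε → ∃ D, ∀ s, 0 < s → f (t + s) ≤ f t + s * (L + c * ε + s * D)) :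
    deriv f t ≤ L := by
  refine le_of_forall_pos_le_add fun η hη => ?_
  obtain ⟨D, hD⟩ := h (η / (c + 1)) (by positivity)
  have hce : c * (η / (c + 1)) ≤ η := by
    rw [← mul_div_assoc, div_le_iff₀ (by positivity)]; nlinarith
  have h1 := hf.hasDerivAt.tendsto_slope_zero_right
  have h2 : Tendsto (fun s : ℝ => L + c * (η / (c + 1)) + s * D) (𝓝[>] 0)
      (𝓝 (L + c * (η / (c + 1)) + 0 * D)) :=
    Tendsto.mono_left (Continuous.tendsto (by fun_prop) 0) nhdsWithin_le_nhds
  have h3 := le_of_tendsto_of_tendsto h1 h2 (by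
    filter_upwards [self_mem_nhdsWithin] with s hs
    have hs : 0 < s := hs
    have := hD s hs
    rw [smul_eq_mul, inv_mul_le_iff₀ hs]
    linarith)
  linarith

theorem Z_super (hz : SS K {θ} C z) (hΛ : 0 ≤ Λ) {a δ A : ℝ} (ha : 2 * C ≤ Λ * a)
    (π : Measure (ℝ × Eu d)) [IsProbabilityMeasure π] (hπ : ∀ᵐ q ∂π, ‖q‖ ≤ δ)
    (hcb : CB A (Avg π (zt C Λ z))) {t : ℝ} (ht0 : 0 ≤ t) (ht : a + δ ≤ t) (x : Eu d) :
    deriv (fun s => Avg π (zt C Λ z) (s, x)) t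
      ≤ Lop θ (fun y => Avg π (zt C Λ z) (t, y)) x := by
  have hC := hz.C0
  have hb := hz.bd
  have hTF := TF.joint hcb
  obtain ⟨A', hA'⟩ := hTF.xcb
  have hg := hA' t ht0
  have hA'0 := hg.nonneg
  refine deriv_le_of_step (c := 2 + 3 * A') ((hTF.tb x).diff t) (by positivity) fun ε hε => ?_
  have hθ : Good K θ := hz.good θ rfl
  obtain ⟨ν, hν, hap⟩ := exists_approx hθ hε
  refine ⟨(3 * K + ε) * (2 * ν.real univ * A'), fun s hs => ?_⟩
  obtain ⟨m, hm, h1, h2⟩ := zt_step hz hΛ ha hs hε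
  have h3 := Z_step (zt_cont hC hb hΛ) (zt_bd hC hb hΛ) m π hπ h1 ht x
  have h4 := h2 _ A' hg ν ε hap x
  nlinarith

end Reg

theorem comparison_core {d : ℕ} {K C : ℝ} {Θ : Set (Trip d)} {u v : ℝ → Eu d → ℝ}
    (hu : SS K Θ C u) (hv : ∀ θ ∈ Θ, SS K {θ} C (fun t x => - v t x)) {L L' : ℝ≥0}
    (hL : LipschitzWith L (u 0)) (hL' : LipschitzWith L' (v 0)) (h0 : ∀ x, u 0 x ≤ v 0 x)
    {t0 : ℝ} (ht0 : 0 < t0) (x0 : Eu d) : u t0 x0 ≤ v t0 x0 := by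
  obtain ⟨θ0, hθ0⟩ := hu.ne
  have hC := hu.C0
  set z : ℝ → Eu d → ℝ := fun t x => - v t x with hzdef
  have hb := (hv θ0 hθ0).bd
  have hLz : LipschitzWith L' (z 0) := by
    refine LipschitzWith.of_dist_le_mul fun x y => ?_
    have := hL'.dist_le_mul x y
    rw [hzdef, dist_neg_neg]; exact this
  refine le_of_forall_pos_le_add fun η hη => ?_
  set ε := η / 4 with hε4
  have hε : 0 < ε := by positivity
  obtain ⟨τ1, hτ1, hl1⟩ := initial_layer hu hL hε
  obtain ⟨τ2, hτ2, hl2⟩ := initial_layer (hv θ0 hθ0) hLz hε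
  set a : ℝ := min (min (τ1 / 5) (τ2 / 5)) (t0 / 4) with ha
  have hapos : 0 < a := by positivity
  have ha1 : 5 * a ≤ τ1 := by
    have : a ≤ τ1 / 5 := (min_le_left _ _).trans (min_le_left _ _)
    linarith
  have ha2 : 5 * a ≤ τ2 := by
    have : a ≤ τ2 / 5 := (min_le_left _ _).trans (min_le_right _ _)
    linarith
  have ha3 : 4 * a ≤ t0 := by
    have : a ≤ t0 / 4 := min_le_right _ _
    linarith
  set Λ : ℝ := 2 * C / a + L' with hΛdef
  have hL0 : (0 : ℝ) ≤ L' := NNReal.coe_nonneg L'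
  have hΛ : 0 ≤ Λ := by positivity
  have hΛL : (L' : ℝ) ≤ Λ := by
    have : 0 ≤ 2 * C / a := by positivity
    linarith
  have hΛa : 2 * C ≤ Λ * a := by
    have : 2 * C / a * a = 2 * C := by field_simp
    have : 0 ≤ (L' : ℝ) * a := by positivity
    rw [hΛdef, add_mul]; linarith
  set δ : ℝ := min a (ε / (Λ + 1)) with hδ
  have hδpos : 0 < δ := by positivity
  have hδa : δ ≤ a := min_le_left _ _
  have hδΛ : Λ * δ ≤ ε := by
    have : δ ≤ ε / (Λ + 1) := min_le_right _ _
    rw [le_div_iff₀ (by positivity)] at this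
    nlinarith
  have hδL : L' * δ ≤ ε := (mul_le_mul_of_nonneg_right hΛL hδpos.le).trans hδΛ
  haveI : (volume : Measure (ℝ × Eu d)).IsAddHaarMeasure :=
    inferInstanceAs ((volume : Measure ℝ).prod (volume : Measure (Eu d))).IsAddHaarMeasure
  obtain ⟨π, hπ, hsupp, A₀, hA₀, hmol⟩ := exists_mollifier (ℝ × Eu d) hδpos
  have hzc := zt_cont (z := z) hC hb hΛ
  have hzb := zt_bd (z := z) hC hb hΛ
  have hcb := hmol (zt C Λ z) C hzc hzb
  set Z : ℝ × Eu d → ℝ := Avg π (zt C Λ z) with hZ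
  -- the initial estimate
  have hstart : ∀ x, Z (3 * a, x) ≤ - v 0 x + 2 * ε := by
    intro x
    have hpt : ∀ q : ℝ × Eu d, ‖q‖ ≤ δ → zt C Λ z ((3 * a, x) + q) ≤ - v 0 x + 2 * ε := by
      intro q hq
      have hq1 : |q.1| ≤ δ := (norm_fst_le q).trans hq
      have hq2 : ‖q.2‖ ≤ δ := (norm_snd_le q).trans hq
      refine zt_le fun p => ?_
      have hvC : -C ≤ z 0 x := (abs_le.mp (hb 0 le_rfl x)).1
      by_cases hfar : a ≤ ‖p - ((3 * a, x) + q)‖ ∨ p.1 < 0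
      · have := zt_far hC hb hΛ hΛa hfar
        change -C ≤ - v 0 x at hvC
        linarith
      · push Not at hfar
        obtain ⟨hf1, hf2⟩ := hfar
        have hp1 : |p.1 - (3 * a + q.1)| < a := (norm_fst_le (p - ((3 * a, x) + q))).trans_lt hf1
        have hp2 : ‖p.2 - (x + q.2)‖ ≤ ‖p - ((3 * a, x) + q)‖ :=
          norm_snd_le (p - ((3 * a, x) + q))
        have e1 : zext C z p = z p.1 p.2 := by unfold zext; rw [if_pos hf2]
        have hl := hl2 p.1 hf2 (by
          have := (abs_lt.mp hp1).2
          have := (abs_le.mp hq1).2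
          linarith) p.2
        have hlip := hLz.dist_le_mul p.2 x
        rw [Real.dist_eq, dist_eq_norm] at hlip
        have hlip' := (abs_le.mp hlip).2
        have htri : ‖p.2 - x‖ ≤ ‖p - ((3 * a, x) + q)‖ + δ := by
          have := norm_add_le (p.2 - (x + q.2)) q.2
          have e : p.2 - (x + q.2) + q.2 = p.2 - x := by abel
          rw [e] at this
          linarith
        have h5 := mul_le_mul_of_nonneg_left htri hL0
        have h6 := mul_le_mul_of_nonneg_right hΛL (norm_nonneg (p - ((3 * a, x) + q)))
        rw [e1]
        change z p.1 p.2 - _ ≤ z 0 x + 2 * ε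
        linarith
    have h1 : Z (3 * a, x) ≤ ∫ _ : ℝ × Eu d, (- v 0 x + 2 * ε) ∂π := by
      refine integral_mono_ae (integrable_shift π hzc hzb _) (integrable_const _) ?_
      filter_upwards [hsupp] with q hq
      exact hpt q hq
    simpa using h1
  have hTFc := TF.joint (hcb.neg.add_const (4 * ε - ε))
  have key := lemma_sub hu.ne hu.good hu.usc hu.bd hu.sub
    (Φ := fun t x => - Z (t, x) + (4 * ε - ε)) (t0 := 3 * a) (T := t0 + 1) hTFc (by positivity) ?_ ?_
    t0 (by linarith) (by linarith) x0
  · have hnear := Avg_near π hsupp hzc hzb hΛ (zt_lip (z := z) hC hb hΛ) (t0, x0)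
    have h1 := (abs_le.mp hnear).1
    have h2 := zext_le_zt (z := z) hC hb hΛ (t0, x0)
    have e1 : zext C z (t0, x0) = - v t0 x0 := by unfold zext; rw [if_pos ht0.le]
    rw [e1] at h2
    linarith
  · intro t ht1 ht2 x θ hθ
    have ht : 0 ≤ t := by linarith
    obtain ⟨A', hA'⟩ := (TF.joint hcb).xcb
    have hg := hA' t ht
    rw [Lop_add_const (hu.good θ hθ) hg.neg, Lop_neg hg]
    have h1 := Z_super (hv θ hθ) hΛ hΛa π hsupp hcb ht (by linarith) x
    rw [deriv_add_const, deriv.fun_neg]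
    linarith
  · intro x
    have h1 := hl1 (3 * a) (by positivity) (by linarith) x
    have h2 := hstart x
    have h3 := h0 x
    linarith

theorem comparison_main {d : ℕ} (Θ : Set (Trip d))
    (hne : Θ.Nonempty) (htrip : IsLevyTripletSet Θ)
    (hK : HasUniformBound Θ)
    (u v : ℝ → Eu d → ℝ)
    (hu_usc : UpperSemicontinuousOn (fun pt : ℝ × Eu d => u pt.1 pt.2)
      (Set.Ici 0 ×ˢ Set.univ))
    (hv_lsc : LowerSemicontinuousOn (fun pt : ℝ × Eu d => v pt.1 pt.2)
      (Set.Ici 0 ×ˢ Set.univ))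
    (hub : ∃ C, ∀ t ∈ Set.Ici (0 : ℝ), ∀ x, |u t x| ≤ C)
    (hvb : ∃ C, ∀ t ∈ Set.Ici (0 : ℝ), ∀ x, |v t x| ≤ C)
    (hsub : IsViscositySubsolution Θ u)
    (hsup : IsViscositySupersolution Θ v)
    (hu0 : ∃ K : ℝ≥0, LipschitzWith K (u 0))
    (hv0 : ∃ K : ℝ≥0, LipschitzWith K (v 0))
    (h0 : ∀ x, u 0 x ≤ v 0 x) :
    ∀ t ∈ Set.Ici (0 : ℝ), ∀ x, u t x ≤ v t x := by
  intro t ht x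
  have ht : 0 ≤ t := ht
  rcases ht.eq_or_lt with rfl | htpos
  · exact h0 x
  obtain ⟨K, hG⟩ := good_of htrip hK
  obtain ⟨C, hC⟩ := hub
  obtain ⟨C', hC'⟩ := hvb
  obtain ⟨L, hL⟩ := hu0
  obtain ⟨L', hL'⟩ := hv0
  refine comparison_core (K := K) (C := max C C') (Θ := Θ)
    ⟨hne, hG, hu_usc, fun t ht x => (hC t ht x).trans (le_max_left _ _), hsub⟩
    (fun θ hθ => ⟨⟨θ, rfl⟩, ?_, ?_, ?_, neg_super hG hsup hθ⟩) hL hL' h0 htpos x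
  · rintro _ rfl; exact hG _ hθ
  · intro p hp y hy
    have := hv_lsc p hp (-y) (by simp only at hy ⊢; linarith)
    filter_upwards [this] with q hq
    linarith
  · intro t ht x
    rw [abs_neg]
    exact (hC' t ht x).trans (le_max_right _ _)

end Helpers

/-- **Statement 15** (Proposition 5.6, comparison principle): if `u` is a bounded upper
semicontinuous viscosity subsolution and `v` a bounded lower semicontinuous viscosity
supersolution of the nonlinear Kolmogorov PIDE, with bounded Lipschitz initial data
satisfying `u(0,·) ≤ v(0,·)`, then `u ≤ v` on `[0,∞) × ℝ^d`. -/
theorem PIDE_comparison_principle {d : ℕ}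
    (Θ : Set (Eu d × Matrix (Fin d) (Fin d) ℝ × Measure (Eu d)))
    (hne : Θ.Nonempty) (hmeas : MeasurableSet Θ) (htrip : IsLevyTripletSet Θ)
    (hK : HasUniformBound Θ) (hKeps : HasVanishingSmallJumps Θ)
    (u v : ℝ → Eu d → ℝ)
    (hu_usc : UpperSemicontinuousOn (fun pt : ℝ × Eu d => u pt.1 pt.2)
      (Set.Ici 0 ×ˢ Set.univ))
    (hv_lsc : LowerSemicontinuousOn (fun pt : ℝ × Eu d => v pt.1 pt.2)
      (Set.Ici 0 ×ˢ Set.univ))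
    (hub : ∃ C, ∀ t ∈ Set.Ici (0 : ℝ), ∀ x, |u t x| ≤ C)
    (hvb : ∃ C, ∀ t ∈ Set.Ici (0 : ℝ), ∀ x, |v t x| ≤ C)
    (hsub : IsViscositySubsolution Θ u)
    (hsup : IsViscositySupersolution Θ v)
    (hu0 : ∃ K : ℝ≥0, LipschitzWith K (u 0))
    (hv0 : ∃ K : ℝ≥0, LipschitzWith K (v 0))
    (h0 : ∀ x, u 0 x ≤ v 0 x) :
    ∀ t ∈ Set.Ici (0 : ℝ), ∀ x, u t x ≤ v t x := by
  exact comparison_main Θ hne htrip hK u v hu_usc hv_lsc hub hvb hsub hsup hu0 hv0 h0
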